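/- arXiv:2107.14477 — 2 statements merged into one kernel-verified Lean document; each statement's English description precedes it below -/
import Mathlib

section
/- Let d ≥ 1 be an odd integer, let a, b, c ∈ F, and suppose the 𝔥-module E_d(a,b,c) is irreducible. Regard each 𝔥-module as an ℜ-module via ζ. Then: (i) if d = 1 the ℜ-module E_d(a,b,c) is irreducible and isomorphic to R₁(−(a+1)/2, −(b+1)/2, −(c+1)/2); (ii) if d ≥ 3 the composition factors of the ℜ-module E_d(a,b,c) are isomorphic to R_{(d+1)/2}(−(a+1)/2, −(b+1)/2, −(c+1)/2) and R_{(d−3)/2}(−(a+1)/2, −(b+1)/2, −(c+1)/2); (iii) the composition factors of the ℜ-module E_d(a,b,c)^{(1,−1)} are isomorphic to R_{(d−1)/2}(−a/2, −(b+1)/2, −(c+1)/2) and R_{(d−1)/2}(−a/2−1, −(b+1)/2, −(c+1)/2); (iv) the composition factors of the ℜ-module E_d(a,b,c)^{(−1,1)} are isomorphic to R_{(d−1)/2}(−(a+1)/2, −b/2, −(c+1)/2) and R_{(d−1)/2}(−(a+1)/2, −b/2−1, −(c+1)/2); (v) the composition factors of the ℜ-module E_d(a,b,c)^{(−1,−1)}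 are isomorphic to R_{(d−1)/2}(−(a+1)/2, −(b+1)/2, −c/2) and R_{(d−1)/2}(−(a+1)/2, −(b+1)/2, −c/2−1). -/
open FreeAlgebra

noncomputable section

variable (F : Type) [Field F]

/-! ## The universal Racah algebra -/

/-- `α = [A,D] + AC - BA` in the free algebra on `A,B,C,D`. -/
def alphaFree : FreeAlgebra F (Fin 4) :=
  ι F 0 * ι F 3 - ι F 3 * ι F 0 + ι F 0 * ι F 2 - ι F 1 * ι F 0

/-- `β = [B,D] + BA - CB` in the free algebra on `A,B,C,D`. -/
def betaFree : FreeAlgebra F (Fin 4) :=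
  ι F 1 * ι F 3 - ι F 3 * ι F 1 + ι F 1 * ι F 0 - ι F 2 * ι F 1

/-- `γ = [C,D] + CB - AC` in the free algebra on `A,B,C,D`. -/
def gammaFree : FreeAlgebra F (Fin 4) :=
  ι F 2 * ι F 3 - ι F 3 * ι F 2 + ι F 2 * ι F 1 - ι F 0 * ι F 2

/-- The defining relations of the universal Racah algebra:
`[A,B] = [B,C] = [C,A] = 2D` and `α`, `β`, `γ` commute with the generators. -/
inductive RacahRel : FreeAlgebra F (Fin 4) → FreeAlgebra F (Fin 4) → Prop
  | AB : RacahRel (ι F 0 * ι F 1 - ι F 1 * ι F 0) (2 * ι F 3)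
  | BC : RacahRel (ι F 1 * ι F 2 - ι F 2 * ι F 1) (2 * ι F 3)
  | CA : RacahRel (ι F 2 * ι F 0 - ι F 0 * ι F 2) (2 * ι F 3)
  | alphaC (i : Fin 4) : RacahRel (alphaFree F * ι F i) (ι F i * alphaFree F)
  | betaC (i : Fin 4) : RacahRel (betaFree F * ι F i) (ι F i * betaFree F)
  | gammaC (i : Fin 4) : RacahRel (gammaFree F * ι F i) (ι F i * gammaFree F)

/-- The universal Racah algebra `ℜ`. -/
abbrev RacahAlg := RingQuot (RacahRel F)

def rA : RacahAlg F := RingQuot.mkAlgHom F (RacahRel F) (ι F 0)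
def rB : RacahAlg F := RingQuot.mkAlgHom F (RacahRel F) (ι F 1)
def rC : RacahAlg F := RingQuot.mkAlgHom F (RacahRel F) (ι F 2)
def rD : RacahAlg F := RingQuot.mkAlgHom F (RacahRel F) (ι F 3)
def rDelta : RacahAlg F := rA F + rB F + rC F
def rAlpha : RacahAlg F := RingQuot.mkAlgHom F (RacahRel F) (alphaFree F)
def rBeta : RacahAlg F := RingQuot.mkAlgHom F (RacahRel F) (betaFree F)
def rGamma : RacahAlg F := RingQuot.mkAlgHom F (RacahRel F) (gammaFree F)

/-! ## The universal additive DAHA of type `(C₁∨, C₁)` -/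

/-- The defining relations: `t₀ + t₁ + t₂ + t₃ = -1` and each `tᵢ²` is central. -/
inductive DAHARel : FreeAlgebra F (Fin 4) → FreeAlgebra F (Fin 4) → Prop
  | sum : DAHARel (ι F 0 + ι F 1 + ι F 2 + ι F 3) (-1)
  | central (i j : Fin 4) : DAHARel (ι F i * ι F i * ι F j) (ι F j * (ι F i * ι F i))

/-- The universal additive DAHA `𝔥` of type `(C₁∨, C₁)`. -/
abbrev DAHAAlg := RingQuot (DAHARel F)

/-- The generators `t₀, t₁, t₂, t₃` of `𝔥`. -/
def tGen (i : Fin 4) : DAHAAlg F := RingQuot.mkAlgHom F (DAHARel F) (ι F i)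

/-! ## Scalar restriction along `algebraMap`, actions as `F`-linear operators -/

/-- The `F`-vector space structure on a module over an `F`-algebra `A`. -/
def resF (A : Type) [Ring A] [Algebra F A] (W : Type) [AddCommGroup W] [Module A W] :
    Module F W := Module.compHom W (algebraMap F A)

theorem resF_tower (A : Type) [Ring A] [Algebra F A] (W : Type) [AddCommGroup W] [Module A W]
    [instF : Module F W] (h : instF = resF F A W) : IsScalarTower F A W := by
  have key : ∀ (a : F) (u : W), a • u = algebraMap F A a • u := by
    intro a u; rw [h]; rfl
  exact ⟨fun a x w => by rw [Algebra.smul_def, mul_smul, key a (x • w)]⟩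

/-- The action of `x : A` on an `A`-module `W` as an `F`-linear operator. -/
def opOf {A : Type} [Ring A] [Algebra F A] (x : A) (W : Type) [AddCommGroup W] [Module F W]
    [Module A W] [IsScalarTower F A W] : Module.End F W where
  toFun w := x • w
  map_add' u v := smul_add x u v
  map_smul' a w := by
    simp only [RingHom.id_apply]
    rw [← algebraMap_smul A a w, ← mul_smul, ← Algebra.commutes, mul_smul, algebraMap_smul]

/-- `x : A` acts diagonalizably on the `A`-module `W`. -/
def ActsDiagOn {A : Type} [Ring A] [Algebra F A] (x : A) (W : Type) [AddCommGroup W]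
    [Module A W] : Prop :=
  letI := resF F A W
  haveI := resF_tower F A W rfl
  (⨆ μ : F, Module.End.eigenspace (opOf F x W) μ) = ⊤

/-- `x : A` acts on the `A`-module `W` in a multiplicity-free way: every eigenvalue of the
action of `x` has algebraic multiplicity one. -/
def ActsMultFreeOn {A : Type} [Ring A] [Algebra F A] (x : A) (W : Type) [AddCommGroup W]
    [Module A W] : Prop :=
  letI := resF F A W
  haveI := resF_tower F A W rfl
  ∀ μ : F, Module.End.HasEigenvalue (opOf F x W) μ →
    Module.finrank F (Module.End.maxGenEigenspace (opOf F x W) μ) = 1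

/-- `x : A` acts on the `A`-module `W` as scalar multiplication by `μ : F`. -/
def actsAsScalar {A : Type} [Ring A] [Algebra F A] (x : A) (μ : F) (W : Type)
    [AddCommGroup W] [Module A W] : Prop :=
  letI := resF F A W
  ∀ u : W, x • u = μ • u

/-- The trace of the action of `x : A` on the `A`-module `W`. -/
def traceOf {A : Type} [Ring A] [Algebra F A] (x : A) (W : Type) [AddCommGroup W]
    [Module A W] : F :=
  letI := resF F A W
  haveI := resF_tower F A W rfl
  LinearMap.trace F W (opOf F x W)

/-! ## Tridiagonal matrices, Leonard pairs and Leonard triples -/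

/-- A square matrix is tridiagonal if each nonzero entry lies on the diagonal, the
superdiagonal, or the subdiagonal. -/
def IsTridiag {n : ℕ} (M : Matrix (Fin n) (Fin n) F) : Prop :=
  ∀ i j : Fin n, M i j ≠ 0 → (i : ℕ) = (j : ℕ) ∨ (i : ℕ) = (j : ℕ) + 1 ∨ (j : ℕ) = (i : ℕ) + 1

/-- A tridiagonal matrix is irreducible if every superdiagonal and subdiagonal entry
is nonzero. -/
def IsIrrTridiag {n : ℕ} (M : Matrix (Fin n) (Fin n) F) : Prop :=
  IsTridiag F M ∧ ∀ i j : Fin n, ((i : ℕ) = (j : ℕ) + 1 ∨ (j : ℕ) = (i : ℕ) + 1) → M i j ≠ 0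

/-- `x, y : A` act on the `A`-module `W` as a Leonard pair. -/
def ActsAsLeonardPairOn {A : Type} [Ring A] [Algebra F A] (x y : A) (W : Type)
    [AddCommGroup W] [Module A W] : Prop :=
  letI := resF F A W
  haveI := resF_tower F A W rfl
  (∃ (n : ℕ) (b : Module.Basis (Fin n) F W),
      (LinearMap.toMatrix b b (opOf F x W)).IsDiag ∧
      IsIrrTridiag F (LinearMap.toMatrix b b (opOf F y W))) ∧
  (∃ (n : ℕ) (b : Module.Basis (Fin n) F W),
      (LinearMap.toMatrix b b (opOf F y W)).IsDiag ∧
      IsIrrTridiag F (LinearMap.toMatrix b b (opOf F x W)))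

/-- `x, y, z : A` act on the `A`-module `W` as a Leonard triple. -/
def ActsAsLeonardTripleOn {A : Type} [Ring A] [Algebra F A] (x y z : A) (W : Type)
    [AddCommGroup W] [Module A W] : Prop :=
  letI := resF F A W
  haveI := resF_tower F A W rfl
  (∃ (n : ℕ) (b : Module.Basis (Fin n) F W),
      (LinearMap.toMatrix b b (opOf F x W)).IsDiag ∧
      IsIrrTridiag F (LinearMap.toMatrix b b (opOf F y W)) ∧
      IsIrrTridiag F (LinearMap.toMatrix b b (opOf F z W))) ∧
  (∃ (n : ℕ) (b : Module.Basis (Fin n) F W),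
      (LinearMap.toMatrix b b (opOf F y W)).IsDiag ∧
      IsIrrTridiag F (LinearMap.toMatrix b b (opOf F z W)) ∧
      IsIrrTridiag F (LinearMap.toMatrix b b (opOf F x W))) ∧
  (∃ (n : ℕ) (b : Module.Basis (Fin n) F W),
      (LinearMap.toMatrix b b (opOf F z W)).IsDiag ∧
      IsIrrTridiag F (LinearMap.toMatrix b b (opOf F x W)) ∧
      IsIrrTridiag F (LinearMap.toMatrix b b (opOf F y W)))

/-! ## The irreducible `ℜ`-modules `R_d(a,b,c)` -/

/-- `θᵢ = (x + d/2 - i)(x + d/2 - i + 1)`. -/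
def thP (x : F) (d i : ℕ) : F := (x + (d : F) / 2 - (i : F)) * (x + (d : F) / 2 - (i : F) + 1)

/-- `φᵢ = i(i-d-1)(a+b+c+d/2-i+2)(a+b-c+d/2-i+1)`. -/
def phP (a b c : F) (d i : ℕ) : F :=
  (i : F) * ((i : F) - (d : F) - 1) * (a + b + c + (d : F) / 2 - (i : F) + 2) *
    (a + b - c + (d : F) / 2 - (i : F) + 1)

/-- `W` is (a copy of) the `(d+1)`-dimensional `ℜ`-module `R_d(a,b,c)`:  there is a basis
with respect to which `A` is lower bidiagonal with diagonal `θᵢ` and subdiagonal entries `1`,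
`B` is upper bidiagonal with diagonal `θᵢ*` and superdiagonal entries `φᵢ`, and `δ` acts as
the prescribed scalar. -/
def IsRdModule (a b c : F) (d : ℕ) (W : Type) [AddCommGroup W] [Module (RacahAlg F) W] :
    Prop :=
  letI := resF F (RacahAlg F) W
  ∃ v : Module.Basis (Fin (d + 1)) F W,
    (∀ i : Fin (d + 1), rA F • (v i : W) = thP F a d i • v i +
      (if h : (i : ℕ) + 1 < d + 1 then v ⟨(i : ℕ) + 1, h⟩ else 0)) ∧
    (∀ i : Fin (d + 1), rB F • (v i : W) = thP F b d i • v i +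
      (if (i : ℕ) = 0 then 0 else
        phP F a b c d i • v ⟨(i : ℕ) - 1, lt_of_le_of_lt (Nat.sub_le _ _) i.isLt⟩)) ∧
    actsAsScalar F (rDelta F)
      ((d : F) / 2 * ((d : F) / 2 + 1) + a * (a + 1) + b * (b + 1) + c * (c + 1)) W

/-! ## The homomorphism `ζ : ℜ → 𝔥` -/

/-- `ζ : ℜ → 𝔥` sends `A, B, C` to the prescribed elements of `𝔥`. -/
def IsZeta (ζ : RacahAlg F →ₐ[F] DAHAAlg F) : Prop :=
  ζ (rA F) = (1 / 4 : F) • ((tGen F 0 + tGen F 1 - 1) * (tGen F 0 + tGen F 1 + 1)) ∧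
  ζ (rB F) = (1 / 4 : F) • ((tGen F 0 + tGen F 2 - 1) * (tGen F 0 + tGen F 2 + 1)) ∧
  ζ (rC F) = (1 / 4 : F) • ((tGen F 0 + tGen F 3 - 1) * (tGen F 0 + tGen F 3 + 1))

/-- A `𝔥`-module considered as an `ℜ`-module via `ζ : ℜ → 𝔥`. -/
def racahModOfDaha (ζ : RacahAlg F →ₐ[F] DAHAAlg F) (V : Type) [AddCommGroup V]
    [Module (DAHAAlg F) V] : Module (RacahAlg F) V :=
  Module.compHom V ζ.toRingHom

/-! ## Composition factors -/

/-- The `i`-th factor of a composition series of submodules. -/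
abbrev csFactor {R V : Type} [Ring R] [AddCommGroup V] [Module R V]
    (s : CompositionSeries (Submodule R V)) (i : Fin s.length) : Type :=
  (↥(s i.succ)) ⧸ Submodule.comap (s i.succ).subtype (s i.castSucc)

/-! ## The `𝔥`-modules `E_d(a,b,c)` and `O_d(a,b,c)` -/

def sigP (a b c : F) (d : ℕ) : F := a + b + c - ((d : F) + 1) / 2
def tauP (a b c : F) (d : ℕ) : F := a + b - c - ((d : F) + 1) / 2
def lamP (a b c : F) (d : ℕ) : F := a - b - c - ((d : F) + 1) / 2
def muP (a b c : F) (d : ℕ) : F := c - a - b - ((d : F) + 1) / 2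
def nuP (a b c : F) (d : ℕ) : F := b - a - c - ((d : F) + 1) / 2

/-- `W` is (a copy of) the `(d+1)`-dimensional `𝔥`-module `E_d(a,b,c)` (`d` odd):  there is
a basis `v₀, …, v_d` (extended by zero to a sequence `w`) on which `t₀, t₁, t₂, t₃` act by the
prescribed formulas. -/
def IsEdModule (a b c : F) (d : ℕ) (W : Type) [AddCommGroup W] [Module (DAHAAlg F) W] :
    Prop :=
  letI := resF F (DAHAAlg F) W
  ∃ (v : Module.Basis (Fin (d + 1)) F W) (w : ℕ → W),
    (∀ i : Fin (d + 1), w i = v i) ∧ (∀ n : ℕ, d < n → w n = 0) ∧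
    (∀ i : ℕ, Even i → 2 ≤ i → i + 1 ≤ d →
      tGen F 0 • w i = ((i : F) * ((d : F) - (i : F) + 1)) • w (i - 1)
        - (((d : F) - 2 * (i : F) + 1) / 2) • w i) ∧
    (∀ i : ℕ, Odd i → i + 2 ≤ d →
      tGen F 0 • w i = (((d : F) - 2 * (i : F) - 1) / 2) • w i + w (i + 1)) ∧
    (tGen F 0 • w 0 = -(((d : F) + 1) / 2) • w 0) ∧
    (tGen F 0 • w d = -(((d : F) + 1) / 2) • w d) ∧
    (∀ i : ℕ, Even i → 2 ≤ i → i + 1 ≤ d →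
      tGen F 1 • w i = ((i : F) * ((i : F) - (d : F) - 1)) • w (i - 1) + a • w i + w (i + 1)) ∧
    (∀ i : ℕ, Odd i → i ≤ d → tGen F 1 • w i = -a • w i) ∧
    (tGen F 1 • w 0 = a • w 0 + w 1) ∧
    (∀ i : ℕ, Even i → i + 1 ≤ d → tGen F 2 • w i = b • w i) ∧
    (∀ i : ℕ, Odd i → i + 2 ≤ d →
      tGen F 2 • w i = -((sigP F a b c d + (i : F)) * (tauP F a b c d + (i : F))) • w (i - 1)
        - b • w i - w (i + 1)) ∧
    (tGen F 2 • w d = -((sigP F a b c d + (d : F)) * (tauP F a b c d + (d : F))) • w (d - 1)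
      - b • w d) ∧
    (∀ i : ℕ, Even i → i + 1 ≤ d →
      tGen F 3 • w i = -((sigP F a b c d + tauP F a b c d + 2 * (i : F) + 2) / 2) • w i
        - w (i + 1)) ∧
    (∀ i : ℕ, Odd i → i ≤ d →
      tGen F 3 • w i = ((sigP F a b c d + (i : F)) * (tauP F a b c d + (i : F))) • w (i - 1)
        + ((sigP F a b c d + tauP F a b c d + 2 * (i : F)) / 2) • w i)

/-- On `E_d(a,b,c)` the elements `t₀², t₁², t₂², t₃²` act as scalar multiplication by
`(d+1)²/4, a², b², c²` respectively. -/
def EdSquares (a b c : F) (d : ℕ) (W : Type) [AddCommGroup W] [Module (DAHAAlg F) W] :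
    Prop :=
  actsAsScalar F (tGen F 0 * tGen F 0) (((d : F) + 1) ^ 2 / 4) W ∧
  actsAsScalar F (tGen F 1 * tGen F 1) (a ^ 2) W ∧
  actsAsScalar F (tGen F 2 * tGen F 2) (b ^ 2) W ∧
  actsAsScalar F (tGen F 3 * tGen F 3) (c ^ 2) W

/-- `W` is (a copy of) the `(d+1)`-dimensional `𝔥`-module `O_d(a,b,c)` (`d` even):  there is
a basis `v₀, …, v_d` (extended by zero to a sequence `w`) on which `t₀, t₁, t₂, t₃` act by the
prescribed formulas. -/
def IsOdModule (a b c : F) (d : ℕ) (W : Type) [AddCommGroup W] [Module (DAHAAlg F) W] :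
    Prop :=
  letI := resF F (DAHAAlg F) W
  ∃ (v : Module.Basis (Fin (d + 1)) F W) (w : ℕ → W),
    (∀ i : Fin (d + 1), w i = v i) ∧ (∀ n : ℕ, d < n → w n = 0) ∧
    (∀ i : ℕ, Even i → 2 ≤ i → i ≤ d →
      tGen F 0 • w i = -((i : F) * (sigP F a b c d + (i : F))) • w (i - 1)
        + ((sigP F a b c d + 2 * (i : F)) / 2) • w i) ∧
    (∀ i : ℕ, Odd i → i + 1 ≤ d →
      tGen F 0 • w i = -((sigP F a b c d + 2 * (i : F) + 2) / 2) • w i + w (i + 1)) ∧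
    (tGen F 0 • w 0 = (sigP F a b c d / 2) • w 0) ∧
    (∀ i : ℕ, Even i → 2 ≤ i → i + 2 ≤ d →
      tGen F 1 • w i = ((i : F) * (sigP F a b c d + (i : F))) • w (i - 1)
        + (lamP F a b c d / 2) • w i + w (i + 1)) ∧
    (∀ i : ℕ, Odd i → i + 1 ≤ d → tGen F 1 • w i = -(lamP F a b c d / 2) • w i) ∧
    (tGen F 1 • w 0 = (lamP F a b c d / 2) • w 0 + w 1) ∧
    (tGen F 1 • w d = ((d : F) * (sigP F a b c d + (d : F))) • w (d - 1)
      + (lamP F a b c d / 2) • w d) ∧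
    (∀ i : ℕ, Even i → i ≤ d → tGen F 2 • w i = (nuP F a b c d / 2) • w i) ∧
    (∀ i : ℕ, Odd i → i + 1 ≤ d →
      tGen F 2 • w i = (((d : F) - (i : F) - 1) * (tauP F a b c d + (i : F))) • w (i - 1)
        - (nuP F a b c d / 2) • w i - w (i + 1)) ∧
    (∀ i : ℕ, Even i → i + 2 ≤ d →
      tGen F 3 • w i = ((2 * (d : F) + muP F a b c d - 2 * (i : F)) / 2) • w i - w (i + 1)) ∧
    (∀ i : ℕ, Odd i → i + 1 ≤ d →
      tGen F 3 • w i = (((i : F) - (d : F) - 1) * (tauP F a b c d + (i : F))) • w (i - 1)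
        - ((2 * (d : F) + muP F a b c d - 2 * (i : F) + 2) / 2) • w i) ∧
    (tGen F 3 • w d = (muP F a b c d / 2) • w d)

/-- On `O_d(a,b,c)` the elements `t₀², t₁², t₂², t₃²` act as the prescribed scalars. -/
def OdSquares (a b c : F) (d : ℕ) (W : Type) [AddCommGroup W] [Module (DAHAAlg F) W] :
    Prop :=
  actsAsScalar F (tGen F 0 * tGen F 0) (((a + b + c) / 2 - ((d : F) + 1) / 4) ^ 2) W ∧
  actsAsScalar F (tGen F 1 * tGen F 1) (((a - b - c) / 2 - ((d : F) + 1) / 4) ^ 2) W ∧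
  actsAsScalar F (tGen F 2 * tGen F 2) (((c - a - b) / 2 - ((d : F) + 1) / 4) ^ 2) W ∧
  actsAsScalar F (tGen F 3 * tGen F 3) (((b - a - c) / 2 - ((d : F) + 1) / 4) ^ 2) W

/-! ## The `{±1}²`-action on `𝔥` and twisted modules -/

theorem dahaSum : tGen F 0 + tGen F 1 + tGen F 2 + tGen F 3 = -1 := by
  have h := RingQuot.mkAlgHom_rel F (DAHARel.sum (F := F))
  simpa [tGen] using h

theorem dahaSqCentral (i j : Fin 4) :
    tGen F i * tGen F i * tGen F j = tGen F j * (tGen F i * tGen F i) := by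
  have h := RingQuot.mkAlgHom_rel F (DAHARel.central (F := F) i j)
  simpa [tGen] using h

/-- The algebra endomorphism of `𝔥` permuting the generators `t₀, t₁, t₂, t₃` by `π`. -/
def dahaAut (π : Equiv.Perm (Fin 4)) : DAHAAlg F →ₐ[F] DAHAAlg F :=
  RingQuot.liftAlgHom F ⟨FreeAlgebra.lift F (fun i => tGen F (π i)), by
    intro x y h
    cases h with
    | sum =>
        simp only [map_add, map_neg, map_one, FreeAlgebra.lift_ι_apply]
        have h4 : tGen F (π 0) + tGen F (π 1) + tGen F (π 2) + tGen F (π 3)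
            = ∑ k : Fin 4, tGen F (π k) := by rw [Fin.sum_univ_four]
        rw [h4, Equiv.sum_comp π (tGen F), Fin.sum_univ_four, dahaSum]
    | central i j =>
        simp only [map_mul, FreeAlgebra.lift_ι_apply]
        exact dahaSqCentral F (π i) (π j)⟩

/-- The element of the Klein group `{±1}²` acting on `𝔥` as the permutation of
`(t₀, t₁, t₂, t₃)` from Table 1. -/
def permOf (ε : ℤˣ × ℤˣ) : Equiv.Perm (Fin 4) :=
  if ε = (1, 1) then 1
  else if ε = (1, -1) then Equiv.swap 0 1 * Equiv.swap 2 3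
  else if ε = (-1, 1) then Equiv.swap 0 2 * Equiv.swap 1 3
  else Equiv.swap 0 3 * Equiv.swap 1 2

/-- The `𝔥`-module `W^ε`: the underlying space of `W` with the action twisted by the
automorphism of `𝔥` given by the permutation `π` of the generators. -/
def twMod (π : Equiv.Perm (Fin 4)) (W : Type) [AddCommGroup W] [Module (DAHAAlg F) W] :
    Module (DAHAAlg F) W :=
  Module.compHom W (dahaAut F π).toRingHom

/-- The trace of `x` on the twisted module `W^π`. -/
def twTrace (π : Equiv.Perm (Fin 4)) (x : DAHAAlg F) (W : Type) [AddCommGroup W]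
    [Module (DAHAAlg F) W] : F :=
  @traceOf F _ (DAHAAlg F) _ _ x W _ (twMod F π W)

/-- `x` acts on the twisted module `W^π` as scalar multiplication by `μ`. -/
def twActsAsScalar (π : Equiv.Perm (Fin 4)) (x : DAHAAlg F) (μ : F) (W : Type)
    [AddCommGroup W] [Module (DAHAAlg F) W] : Prop :=
  @actsAsScalar F _ (DAHAAlg F) _ _ x μ W _ (twMod F π W)

/-- The twisted module `W^π` is (a copy of) `E_d(a,b,c)`. -/
def twIsEdModule (π : Equiv.Perm (Fin 4)) (a b c : F) (d : ℕ) (W : Type) [AddCommGroup W]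
    [Module (DAHAAlg F) W] : Prop :=
  @IsEdModule F _ a b c d W _ (twMod F π W)

end

/-- A composition series of a module that is an extension of two simple modules has length two,
and its factors are, in some order, the kernel and the range of the extension. -/
theorem compositionSeries_of_simple_ker_range {R V : Type} [Ring R] [AddCommGroup V] [Module R V]
    (f : V →ₗ[R] V) [IsSimpleModule R (LinearMap.ker f)] [IsSimpleModule R (LinearMap.range f)]
    (s : CompositionSeries (Submodule R V)) (hs₀ : s.head = ⊥) (hs₁ : s.last = ⊤) :
    s.length = 2 ∧ ∃ i j : Fin s.length, i ≠ j ∧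
      Nonempty (LinearMap.ker f ≃ₗ[R] csFactor s i) ∧
      Nonempty (LinearMap.range f ≃ₗ[R] csFactor s j) := by
  have hbot : (⊥ : Submodule R V) ⋖ LinearMap.ker f :=
    bot_covBy_iff.2 (isSimpleModule_iff_isAtom.1 inferInstance)
  have htop : LinearMap.ker f ⋖ ⊤ :=
    covBy_top_iff.2 (isSimpleModule_iff_isCoatom.1 (IsSimpleModule.congr f.quotKerEquivRange))
  let t : CompositionSeries (Submodule R V) :=
    { length := 2
      toFun := ![⊥, LinearMap.ker f, ⊤]
      step := by
        intro i
        fin_cases i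
        · exact hbot
        · exact htop }
  obtain ⟨e, he⟩ := CompositionSeries.jordan_holder t s (by rw [hs₀]; rfl) (by rw [hs₁]; rfl)
  refine ⟨by simpa using (Fintype.card_congr e).symm, e (0 : Fin 2), e (1 : Fin 2), ?_, ⟨?_⟩, ⟨?_⟩⟩
  · exact e.injective.ne (by decide : (0 : Fin 2) ≠ 1)
  · have e₀ : LinearMap.ker f ≃ₗ[R] (LinearMap.ker f) ⧸
        Submodule.comap (LinearMap.ker f).subtype (⊥ : Submodule R V) :=
      (Submodule.quotEquivOfEqBot _ (Submodule.ker_subtype _)).symm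
    exact e₀.trans (JordanHolderLattice.Iso.linearEquiv (he (0 : Fin 2)))
  · have e₁ : (V ⧸ LinearMap.ker f) ≃ₗ[R] (⊤ : Submodule R V) ⧸
        Submodule.comap (⊤ : Submodule R V).subtype (LinearMap.ker f) :=
      (Submodule.Quotient.equiv _ _ (Submodule.topEquiv (R := R) (M := V)) (by
        ext x
        simp)).symm
    exact (f.quotKerEquivRange.symm.trans e₁).trans
      (JordanHolderLattice.Iso.linearEquiv (he (1 : Fin 2)))

/-- Let `S, P, Q` and `1 + S + P + Q` have scalar squares and act irreducibly. A nonzero subspace `U`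
of an eigenspace of `S` stable under the anticommutators of `S` with `P` and `Q` contains the image
of `S + e`. -/
theorem add_smul_mem_of_stable {F V : Type} [Field F] [CharZero F] [AddCommGroup V] [Module F V]
    (S P Q : Module.End F V) (e x y z : F)
    (hS : ∀ v, S (S v) = e ^ 2 • v) (hP : ∀ v, P (P v) = x • v) (hQ : ∀ v, Q (Q v) = y • v)
    (hR : ∀ v, (1 + S + P + Q) ((1 + S + P + Q) v) = z • v)
    (hsimple : ∀ W : Submodule F V, (∀ w ∈ W, S w ∈ W) → (∀ w ∈ W, P w ∈ W) →
      (∀ w ∈ W, Q w ∈ W) → W = ⊥ ∨ W = ⊤)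
    (U : Submodule F V) (hU : U ≠ ⊥) (hUS : ∀ u ∈ U, S u = e • u)
    (hUP : ∀ u ∈ U, S (P u) + P (S u) ∈ U) (hUQ : ∀ u ∈ U, S (Q u) + Q (S u) ∈ U) (v : V) :
    S v + e • v ∈ U := by
  obtain ⟨X, hX⟩ : ∃ X : V → V, ∀ u, S (P u) + P (S u) = X u := ⟨_, fun _ => rfl⟩
  obtain ⟨X', hX'⟩ : ∃ X' : V → V, ∀ u, S (Q u) + Q (S u) = X' u := ⟨_, fun _ => rfl⟩
  simp only [hX, hX'] at hUP hUQ
  have hSP : ∀ u ∈ U, S (P u) = X u - e • P u := fun u hu => by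
    rw [← hX, hUS u hu, map_smul]; module
  have hSQ : ∀ u ∈ U, S (Q u) = X' u - e • Q u := fun u hu => by
    rw [← hX', hUS u hu, map_smul]; module
  have hR' : ∀ w, Q (P w) + P (Q w) = (z - 1 - e ^ 2 - x - y) • w - (2 : F) • S w - (2 : F) • P w
      - (2 : F) • Q w - X w - X' w := fun w => by
    have h := hR w
    simp only [LinearMap.add_apply, Module.End.one_apply, map_add, hS, hP, hQ] at h
    rw [← hX, ← hX']
    linear_combination (norm := module) h
  have hQP : ∀ u ∈ U, Q (P u) = (z - 1 - e ^ 2 - x - y - 2 * e) • u - (2 : F) • P u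
      - (2 : F) • Q u - X u - X' u - P (Q u) := fun u hu => by
    have h := hR' u
    rw [hUS u hu] at h
    linear_combination (norm := module) h
  have hXQ : ∀ w, S (P (Q w)) + P (S (Q w)) = Q (S (P w)) + Q (P (S w))
      - (2 : F) • (S (Q w) - Q (S w)) - (2 : F) • (P (Q w) - Q (P w)) := fun w => by
    have h := hR (Q w)
    have h' := congrArg Q (hR w)
    simp only [LinearMap.add_apply, Module.End.one_apply, map_add, hS, hP, hQ, map_smul] at h h'
    linear_combination (norm := module) h - h'
  have hSPQ : ∀ u ∈ U, S (P (Q u)) = Q (X u) - P (X' u) - (2 : F) • (X' u - (2 * e) • Q u)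
      - (4 : F) • P (Q u) + (2 : F) • (Q (P u) + P (Q u)) + e • P (Q u) := fun u hu => by
    have h := hXQ u
    have h1 : Q (S (P u)) + Q (P (S u)) = Q (X u) := by rw [← map_add, hX]
    rw [h1, hSQ u hu, hUS u hu] at h
    simp only [map_sub, map_smul] at h
    linear_combination (norm := module) h
  have hQPQ : ∀ u ∈ U, Q (P (Q u)) = (z - 1 - e ^ 2 - x - y - 2 * e) • Q u - (2 : F) • Q (P u)
      - (2 * y) • u - Q (X u) - Q (X' u) - y • P u := fun u hu => by
    have h := congrArg Q (hQP u hu)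
    simp only [map_sub, map_smul, hQ] at h
    linear_combination (norm := module) h
  let W : Submodule F V := U ⊔ U.map P ⊔ U.map Q ⊔ U.map (P * Q)
  have m0 : ∀ u ∈ U, u ∈ W := fun u hu =>
    Submodule.mem_sup_left (Submodule.mem_sup_left (Submodule.mem_sup_left hu))
  have m1 : ∀ u ∈ U, P u ∈ W := fun u hu => Submodule.mem_sup_left
    (Submodule.mem_sup_left (Submodule.mem_sup_right (Submodule.mem_map_of_mem hu)))
  have m2 : ∀ u ∈ U, Q u ∈ W := fun u hu => Submodule.mem_sup_left
    (Submodule.mem_sup_right (Submodule.mem_map_of_mem hu))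
  have m3 : ∀ u ∈ U, P (Q u) ∈ W := fun u hu => Submodule.mem_sup_right
    (Submodule.mem_map_of_mem (f := P * Q) hu)
  have mQP : ∀ u ∈ U, Q (P u) ∈ W := fun u hu => by
    rw [hQP u hu]
    exact sub_mem (sub_mem (sub_mem (sub_mem (sub_mem (W.smul_mem _ (m0 u hu))
      (W.smul_mem _ (m1 u hu))) (W.smul_mem _ (m2 u hu))) (m0 _ (hUP u hu))) (m0 _ (hUQ u hu)))
      (m3 u hu)
  have stable : ∀ (T : Module.End F V) (W' : Submodule F V), (∀ u ∈ U, T u ∈ W') →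
      (∀ u ∈ U, T (P u) ∈ W') → (∀ u ∈ U, T (Q u) ∈ W') → (∀ u ∈ U, T (P (Q u)) ∈ W') →
      ∀ w ∈ W, T w ∈ W' := fun T W' h0 h1 h2 h3 => by
    change W ≤ W'.comap T
    refine sup_le (sup_le (sup_le h0 ?_) ?_) ?_ <;> rw [Submodule.map_le_iff_le_comap]
    exacts [h1, h2, h3]
  have hWS : ∀ w ∈ W, S w ∈ W := by
    refine stable S W (fun u hu => ?_) (fun u hu => ?_) (fun u hu => ?_) (fun u hu => ?_)
    · rw [hUS u hu]; exact W.smul_mem _ (m0 u hu)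
    · rw [hSP u hu]; exact sub_mem (m0 _ (hUP u hu)) (W.smul_mem _ (m1 u hu))
    · rw [hSQ u hu]; exact sub_mem (m0 _ (hUQ u hu)) (W.smul_mem _ (m2 u hu))
    · rw [hSPQ u hu]
      exact add_mem (add_mem (sub_mem (sub_mem (sub_mem (m2 _ (hUP u hu)) (m1 _ (hUQ u hu)))
        (W.smul_mem _ (sub_mem (m0 _ (hUQ u hu)) (W.smul_mem _ (m2 u hu)))))
        (W.smul_mem _ (m3 u hu))) (W.smul_mem _ (add_mem (mQP u hu) (m3 u hu))))
        (W.smul_mem _ (m3 u hu))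
  have hWP : ∀ w ∈ W, P w ∈ W := by
    refine stable P W m1 (fun u hu => ?_) m3 (fun u hu => ?_)
    · rw [hP]; exact W.smul_mem _ (m0 u hu)
    · rw [hP]; exact W.smul_mem _ (m2 u hu)
  have hWQ : ∀ w ∈ W, Q w ∈ W := by
    refine stable Q W m2 mQP (fun u hu => ?_) (fun u hu => ?_)
    · rw [hQ]; exact W.smul_mem _ (m0 u hu)
    · rw [hQPQ u hu]
      exact sub_mem (sub_mem (sub_mem (sub_mem (sub_mem (W.smul_mem _ (m2 u hu))
        (W.smul_mem _ (mQP u hu))) (W.smul_mem _ (m0 u hu))) (m2 _ (hUP u hu)))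
        (m2 _ (hUQ u hu))) (W.smul_mem _ (m1 u hu))
  have hW : W = ⊤ := (hsimple W hWS hWP hWQ).resolve_left fun h =>
    hU (le_bot_iff.1 (h ▸ (show U ≤ W from m0)))
  have k0 : ∀ u ∈ U, S u + e • u ∈ U := fun u hu => by
    rw [hUS u hu]; exact add_mem (U.smul_mem _ hu) (U.smul_mem _ hu)
  have k1 : ∀ u ∈ U, S (P u) + e • P u ∈ U := fun u hu => by
    rw [hSP u hu, sub_add_cancel]; exact hUP u hu
  have k2 : ∀ u ∈ U, S (Q u) + e • Q u ∈ U := fun u hu => by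
    rw [hSQ u hu, sub_add_cancel]; exact hUQ u hu
  have k3 : ∀ u ∈ U, S (P (Q u)) + e • P (Q u) ∈ U := fun u hu => by
    have hY : S (Q (P u) + P (Q u)) + e • (Q (P u) + P (Q u)) =
        (z - 1 - e ^ 2 - x - y - 2 * e) • (S u + e • u) - (2 : F) • (S (P u) + e • P u)
        - (2 : F) • (S (Q u) + e • Q u) - (S (X u) + e • X u) - (S (X' u) + e • X' u) := by
      rw [hQP u hu]
      simp only [map_add, map_sub, map_smul]
      module
    have hYU : S (Q (P u) + P (Q u)) + e • (Q (P u) + P (Q u)) ∈ U := by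
      rw [hY]
      exact sub_mem (sub_mem (sub_mem (sub_mem (U.smul_mem _ (k0 u hu)) (U.smul_mem _ (k1 u hu)))
        (U.smul_mem _ (k2 u hu))) (k0 _ (hUP u hu))) (k0 _ (hUQ u hu))
    have h : (4 : F) • (S (P (Q u)) + e • P (Q u)) =
        (2 : F) • (S (Q (P u) + P (Q u)) + e • (Q (P u) + P (Q u)))
        - (X (X' u) - X' (X u)) := by
      have h1 := congrArg S (hXQ u)
      have h2 := hXQ (S u)
      rw [← hX, ← hX, ← hX', ← hX']
      simp only [hUS u hu, map_add, map_sub, map_smul, hS] at h1 h2 ⊢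
      linear_combination (norm := module) h1 + h2
    have h4 : S (P (Q u)) + e • P (Q u) = (4 : F)⁻¹ • ((4 : F) •
        (S (P (Q u)) + e • P (Q u))) := by
      rw [smul_smul, inv_mul_cancel₀ (by norm_num), one_smul]
    rw [h4, h]
    exact U.smul_mem _ (sub_mem (U.smul_mem _ hYU)
      (sub_mem (hUP _ (hUQ u hu)) (hUQ _ (hUP u hu))))
  exact stable (S + e • 1) U k0 k1 k2 k3 v (hW ▸ Submodule.mem_top)

theorem resF_eq {F A W : Type} [Field F] [Ring A] [Algebra F A] [AddCommGroup W] [Module A W]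
    [inst : Module F W] [IsScalarTower F A W] : inst = resF F A W :=
  Module.ext' _ _ fun r w => (algebraMap_smul A r w).symm

theorem isRdModule_iff {F W : Type} [Field F] [AddCommGroup W] [Module (RacahAlg F) W]
    [Module F W] [IsScalarTower F (RacahAlg F) W] (a b c : F) (d : ℕ) :
    IsRdModule F a b c d W ↔ ∃ v : Module.Basis (Fin (d + 1)) F W,
      (∀ i : Fin (d + 1), rA F • (v i : W) = thP F a d i • v i +
        (if h : (i : ℕ) + 1 < d + 1 then v ⟨(i : ℕ) + 1, h⟩ else 0)) ∧
      (∀ i : Fin (d + 1), rB F • (v i : W) = thP F b d i • v i +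
        (if (i : ℕ) = 0 then 0 else
          phP F a b c d i • v ⟨(i : ℕ) - 1, lt_of_le_of_lt (Nat.sub_le _ _) i.isLt⟩)) ∧
      ∀ u : W, rDelta F • u =
        ((d : F) / 2 * ((d : F) / 2 + 1) + a * (a + 1) + b * (b + 1) + c * (c + 1)) • u := by
  obtain rfl := resF_eq (F := F) (A := RacahAlg F) (W := W)
  rfl

theorem IsRdModule.congr {F W W' : Type} [Field F] [AddCommGroup W] [Module (RacahAlg F) W]
    [AddCommGroup W'] [Module (RacahAlg F) W'] {a b c : F} {d : ℕ}
    (h : IsRdModule F a b c d W) (g : W ≃ₗ[RacahAlg F] W') : IsRdModule F a b c d W' := by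
  let : Module F W := resF F (RacahAlg F) W
  let : Module F W' := resF F (RacahAlg F) W'
  have : IsScalarTower F (RacahAlg F) W := resF_tower F (RacahAlg F) W rfl
  have : IsScalarTower F (RacahAlg F) W' := resF_tower F (RacahAlg F) W' rfl
  rw [isRdModule_iff] at h ⊢
  obtain ⟨v, hA, hB, hδ⟩ := h
  have hg : ∀ (t : F) (w : W), g (t • w) = t • g w := (g.restrictScalars F).map_smul
  refine ⟨v.map (g.restrictScalars F), fun i => ?_, fun i => ?_, fun u => ?_⟩
  · have := congrArg g (hA i)
    simp only [map_smul, map_add, hg] at this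
    simp only [Module.Basis.map_apply, LinearEquiv.restrictScalars_apply, this]
    split_ifs <;> simp
  · have := congrArg g (hB i)
    simp only [map_smul, map_add, hg] at this
    simp only [Module.Basis.map_apply, LinearEquiv.restrictScalars_apply, this]
    split_ifs <;> simp [hg]
  · have := congrArg g (hδ (g.symm u))
    simpa only [map_smul, hg, LinearEquiv.apply_symm_apply] using this

theorem exists_basis_smul {F M : Type} [Field F] [AddCommGroup M] [Module F M] {n : ℕ}
    (y : Fin (n + 1) → M) (hy : LinearIndependent F y) (hM : Module.finrank F M = n + 1)
    (t : Fin (n + 1) → F) (ht : ∀ k, t k ≠ 0) :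
    ∃ v : Module.Basis (Fin (n + 1)) F M, ∀ k, v k = t k • y k := by
  refine ⟨(basisOfLinearIndependentOfCardEqFinrank hy (by rw [hM, Fintype.card_fin])).isUnitSMul
    (w := t) fun k => IsUnit.mk0 _ (ht k), fun k => ?_⟩
  rw [Module.Basis.isUnitSMul_apply, coe_basisOfLinearIndependentOfCardEqFinrank]

theorem exists_bidiagonal_basis {F R V : Type} [Field F] [CharZero F] [Ring R] [Algebra F R]
    [AddCommGroup V] [Module R V] [Module F V] [IsScalarTower F R V] (A B δ : R)
    (N : Submodule R V) (a b c : F) (n : ℕ) (x : ℕ → V) (hx : ∀ k ≤ n, x k ∈ N)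
    (hli : LinearIndependent F fun k : Fin (n + 1) => x k) (hN : Module.finrank F N = n + 1)
    (hxn : x (n + 1) = 0)
    (hA : ∀ k ≤ n, A • x k = thP F a n k • x k + (4 : F)⁻¹ • x (k + 1))
    (hB : ∀ k ≤ n, B • x k = thP F b n k • x k + (4 * phP F a b c n k) • x (k - 1))
    (hδ : ∀ u ∈ N, δ • u =
      ((n : F) / 2 * ((n : F) / 2 + 1) + a * (a + 1) + b * (b + 1) + c * (c + 1)) • u) :
    ∃ v : Module.Basis (Fin (n + 1)) F N,
      (∀ i : Fin (n + 1), A • (v i : N) = thP F a n i • v i +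
        (if h : (i : ℕ) + 1 < n + 1 then v ⟨(i : ℕ) + 1, h⟩ else 0)) ∧
      (∀ i : Fin (n + 1), B • (v i : N) = thP F b n i • v i +
        (if (i : ℕ) = 0 then 0 else
          phP F a b c n i • v ⟨(i : ℕ) - 1, lt_of_le_of_lt (Nat.sub_le _ _) i.isLt⟩)) ∧
      ∀ u : N, δ • u =
        ((n : F) / 2 * ((n : F) / 2 + 1) + a * (a + 1) + b * (b + 1) + c * (c + 1)) • u := by
  have hk : ∀ k : Fin (n + 1), (k : ℕ) ≤ n := fun k => Nat.lt_succ_iff.1 k.isLt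
  have h4 : (4 : F) ≠ 0 := by norm_num
  let y : Fin (n + 1) → N := fun k => ⟨x k, hx k (hk k)⟩
  have hy : LinearIndependent F y := by
    refine LinearIndependent.of_comp (N.subtype.restrictScalars F) ?_
    have : (N.subtype.restrictScalars F : N → V) ∘ y = fun k : Fin (n + 1) => x k := rfl
    rw [this]
    exact hli
  obtain ⟨v, hv'⟩ := exists_basis_smul y hy hN (fun k => ((4 : F) ^ (k : ℕ))⁻¹)
    fun k => inv_ne_zero (pow_ne_zero _ h4)
  have hv : ∀ k : Fin (n + 1), ((v k : N) : V) = ((4 : F) ^ (k : ℕ))⁻¹ • x k := fun k => by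
    rw [hv', Submodule.coe_smul_of_tower]
  have hcomm : ∀ (r : R) (t : F) (w : V), r • t • w = t • r • w := fun r t w => by
    rw [← algebraMap_smul (R) t w, ← mul_smul, ← Algebra.commutes, mul_smul,
      algebraMap_smul]
  refine ⟨v, fun i => ?_, fun i => ?_, fun u => Subtype.ext (hδ u u.2)⟩
  · apply Subtype.ext
    rw [Submodule.coe_smul, Submodule.coe_add, Submodule.coe_smul_of_tower, hv, hcomm, hA i (hk i)]
    split_ifs with h
    · rw [hv, smul_add, smul_comm, smul_smul _ (4 : F)⁻¹, pow_succ, mul_inv]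
    · have : (i : ℕ) + 1 = n + 1 := by have := hk i; omega
      rw [this, hxn, smul_zero, add_zero, smul_comm, Submodule.coe_zero, add_zero]
  · apply Subtype.ext
    rw [Submodule.coe_smul, Submodule.coe_add, Submodule.coe_smul_of_tower, hv, hcomm, hB i (hk i)]
    split_ifs with h
    · simp [h, phP]
    · rw [Submodule.coe_smul_of_tower, hv, smul_add, smul_comm]
      congr 1
      obtain ⟨j, hj⟩ := Nat.exists_eq_succ_of_ne_zero h
      simp only [hj, Nat.succ_eq_add_one, Nat.add_sub_cancel, smul_smul]
      congr 1
      field_simp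
      ring

/-- A submodule is a copy of `R_n(a,b,c)` once it carries a basis `x₀, …, xₙ` on which `A` and `B`
are bidiagonal with subdiagonal entries `1/4` and superdiagonal entries `4φᵢ`. -/
theorem isRdModule_of_bidiagonal {F V : Type} [Field F] [CharZero F] [AddCommGroup V]
    [Module (RacahAlg F) V] [Module F V] [IsScalarTower F (RacahAlg F) V]
    (N : Submodule (RacahAlg F) V) (a b c : F) (n : ℕ) (x : ℕ → V) (hx : ∀ k ≤ n, x k ∈ N)
    (hli : LinearIndependent F fun k : Fin (n + 1) => x k) (hN : Module.finrank F N = n + 1)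
    (hxn : x (n + 1) = 0)
    (hA : ∀ k ≤ n, rA F • x k = thP F a n k • x k + (4 : F)⁻¹ • x (k + 1))
    (hB : ∀ k ≤ n, rB F • x k = thP F b n k • x k + (4 * phP F a b c n k) • x (k - 1))
    (hδ : ∀ u ∈ N, rDelta F • u =
      ((n : F) / 2 * ((n : F) / 2 + 1) + a * (a + 1) + b * (b + 1) + c * (c + 1)) • u) :
    IsRdModule F a b c n N :=
  (isRdModule_iff _ _ _ _).2
    (exists_bidiagonal_basis (rA F) (rB F) (rDelta F) N a b c n x hx hli hN hxn hA hB hδ)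

theorem ringQuot_subalgebra_eq_top {F X : Type} [Field F]
    {r : FreeAlgebra F X → FreeAlgebra F X → Prop} (S : Subalgebra F (RingQuot r))
    (h : ∀ i, RingQuot.mkAlgHom F r (ι F i) ∈ S) : S = ⊤ := by
  have h1 : S.comap (RingQuot.mkAlgHom F r) = ⊤ := by
    rw [← top_le_iff, ← FreeAlgebra.adjoin_range_ι, Algebra.adjoin_le_iff]
    rintro _ ⟨i, rfl⟩
    exact h i
  rw [eq_top_iff]
  intro y _
  obtain ⟨z, rfl⟩ := RingQuot.mkAlgHom_surjective F r y
  have : z ∈ S.comap (RingQuot.mkAlgHom F r) := h1 ▸ Algebra.mem_top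
  exact this

theorem racah_subalgebra_eq_top {F : Type} [Field F] [CharZero F] (S : Subalgebra F (RacahAlg F))
    (hA : rA F ∈ S) (hB : rB F ∈ S) (hC : rC F ∈ S) : S = ⊤ := by
  refine ringQuot_subalgebra_eq_top S fun i => ?_
  fin_cases i
  · exact hA
  · exact hB
  · exact hC
  · have h : rA F * rB F - rB F * rA F = 2 * rD F := by
      simpa [rA, rB, rD, map_ofNat] using RingQuot.mkAlgHom_rel F (RacahRel.AB (F := F))
    have h' : rD F = (2 : F)⁻¹ • (rA F * rB F - rB F * rA F) := by
      rw [h, two_mul, ← two_smul F (rD F), smul_smul, inv_mul_cancel₀ two_ne_zero, one_smul]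
    change rD F ∈ S
    rw [h']
    exact S.smul_mem (sub_mem (mul_mem hA hB) (mul_mem hB hA)) _

/-- A subspace of a simple `𝔥`-module stable under the generators is trivial. -/
theorem eq_bot_or_eq_top_of_tGen_stable {F V : Type} [Field F] [AddCommGroup V] [Module F V]
    [Module (DAHAAlg F) V] [IsScalarTower F (DAHAAlg F) V] [IsSimpleModule (DAHAAlg F) V]
    (W : Submodule F V) (h : ∀ i, ∀ w ∈ W, tGen F i • w ∈ W) : W = ⊥ ∨ W = ⊤ := by
  let S : Subalgebra F (DAHAAlg F) :=
    { carrier := {x | ∀ w ∈ W, x • w ∈ W}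
      mul_mem' := fun hx hy w hw => by rw [mul_smul]; exact hx _ (hy w hw)
      add_mem' := fun hx hy w hw => by rw [add_smul]; exact add_mem (hx w hw) (hy w hw)
      algebraMap_mem' := fun t w hw => by rw [algebraMap_smul]; exact W.smul_mem t hw }
  have hS : S = ⊤ := ringQuot_subalgebra_eq_top S h
  let W' : Submodule (DAHAAlg F) V :=
    { W.toAddSubmonoid with
      smul_mem' := fun x w hw => (show x ∈ S from hS ▸ Algebra.mem_top) w hw }
  have hW : ∀ w, w ∈ W' ↔ w ∈ W := fun _ => Iff.rfl
  rcases eq_bot_or_eq_top W' with h' | h'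
  · left
    ext w
    rw [← hW, h', Submodule.mem_bot, Submodule.mem_bot]
  · right
    ext w
    simp [← hW, h']

theorem finrank_ker_range_of_linearIndependent {F R V : Type} [Field F] [Ring R] [Algebra F R]
    [AddCommGroup V] [Module R V] [Module F V] [IsScalarTower F R V] [FiniteDimensional F V]
    (f : V →ₗ[R] V) {n m : ℕ} (x y : ℕ → V) (hx : ∀ k ≤ n, x k ∈ LinearMap.ker f)
    (hy : ∀ k ≤ m, y k ∈ LinearMap.range f)
    (hxli : LinearIndependent F fun k : Fin (n + 1) => x k)
    (hyli : LinearIndependent F fun k : Fin (m + 1) => y k)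
    (hV : Module.finrank F V = n + 1 + (m + 1)) :
    Module.finrank F (LinearMap.ker f) = n + 1 ∧ Module.finrank F (LinearMap.range f) = m + 1 := by
  let g : V →ₗ[F] V := f.restrictScalars F
  have hg : Module.finrank F (LinearMap.range g) + Module.finrank F (LinearMap.ker g) =
      n + 1 + (m + 1) := by rw [g.finrank_range_add_finrank_ker, hV]
  have h1 : n + 1 ≤ Module.finrank F (LinearMap.ker g) := by
    have : LinearIndependent F fun k : Fin (n + 1) =>
        (⟨x k, hx k (Nat.lt_succ_iff.1 k.isLt)⟩ : LinearMap.ker g) :=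
      LinearIndependent.of_comp (LinearMap.ker g).subtype hxli
    simpa using this.fintype_card_le_finrank
  have h2 : m + 1 ≤ Module.finrank F (LinearMap.range g) := by
    have : LinearIndependent F fun k : Fin (m + 1) =>
        (⟨y k, hy k (Nat.lt_succ_iff.1 k.isLt)⟩ : LinearMap.range g) :=
      LinearIndependent.of_comp (LinearMap.range g).subtype hyli
    simpa using this.fintype_card_le_finrank
  have h3 : Module.finrank F (LinearMap.ker g) = n + 1 := by omega
  have h4 : Module.finrank F (LinearMap.range g) = m + 1 := by omega
  exact ⟨h3, h4⟩

theorem mem_range_of_sq_eq_zero {F R V : Type} [Field F] [Ring R] [Algebra F R]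
    [AddCommGroup V] [Module R V] [Module F V] [IsScalarTower F R V] [FiniteDimensional F V]
    (f : V →ₗ[R] V) (hf : ∀ v, f (f v) = 0)
    (h : Module.finrank F (LinearMap.ker f) = Module.finrank F (LinearMap.range f)) {v : V}
    (hv : f v = 0) : ∃ u, f u = v := by
  let g : V →ₗ[F] V := f.restrictScalars F
  have hle : LinearMap.range g ≤ LinearMap.ker g := by
    rintro _ ⟨u, rfl⟩
    exact hf u
  have heq : LinearMap.range g = LinearMap.ker g := Submodule.eq_of_le_of_finrank_eq hle h.symm
  have : v ∈ LinearMap.range g := heq ▸ hv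
  exact this

theorem quarter_smul {F R V : Type} [Field F] [Ring R] [Algebra F R]
    [AddCommGroup V] [Module R V] [Module F V] [IsScalarTower F R V] (g : R) (v : V) :
    ((1 / 4 : F) • ((g - 1) * (g + 1))) • v = (4 : F)⁻¹ • (g • g • v - v) := by
  rw [smul_assoc, one_div, show (g - 1) * (g + 1) = g * g - 1 by noncomm_ring, sub_smul, mul_smul,
    one_smul]

/-- `η` sends `A, B, C` to the images under the permutation `π` of the elements defining `ζ`. -/
structure IsZetaTwist {F : Type} [Field F] (π : Equiv.Perm (Fin 4))
    (η : RacahAlg F →ₐ[F] DAHAAlg F) : Prop where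
  map_A : η (rA F) = (1 / 4 : F) •
    ((tGen F (π 0) + tGen F (π 1) - 1) * (tGen F (π 0) + tGen F (π 1) + 1))
  map_B : η (rB F) = (1 / 4 : F) •
    ((tGen F (π 0) + tGen F (π 2) - 1) * (tGen F (π 0) + tGen F (π 2) + 1))
  map_C : η (rC F) = (1 / 4 : F) •
    ((tGen F (π 0) + tGen F (π 3) - 1) * (tGen F (π 0) + tGen F (π 3) + 1))

theorem dahaSum_perm {F : Type} [Field F] (π : Equiv.Perm (Fin 4)) :
    tGen F (π 0) + tGen F (π 1) + tGen F (π 2) + tGen F (π 3) = -1 := by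
  have h : tGen F (π 0) + tGen F (π 1) + tGen F (π 2) + tGen F (π 3)
      = ∑ k : Fin 4, tGen F (π k) := by rw [Fin.sum_univ_four]
  rw [h, Equiv.sum_comp π (tGen F), Fin.sum_univ_four, dahaSum]

theorem commute_quarter {F R : Type} [Field F] [Ring R] [Algebra F R] (s p : R)
    (hs : s * s * p = p * (s * s)) (hp : p * p * s = s * (p * p)) :
    s * ((1 / 4 : F) • ((s + p - 1) * (s + p + 1))) =
      (1 / 4 : F) • ((s + p - 1) * (s + p + 1)) * s := by
  rw [mul_smul_comm, smul_mul_assoc]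
  congr 1
  have h1 : s * ((s + p - 1) * (s + p + 1)) - (s + p - 1) * (s + p + 1) * s =
      (s * s * p - p * (s * s)) - (p * p * s - s * (p * p)) := by noncomm_ring
  rw [← sub_eq_zero, h1, hs, hp, sub_self, sub_self, sub_self]

theorem IsZetaTwist.commute {F : Type} [Field F] [CharZero F] {π : Equiv.Perm (Fin 4)}
    {η : RacahAlg F →ₐ[F] DAHAAlg F} (h : IsZetaTwist π η) (r : RacahAlg F) :
    tGen F (π 0) * η r = η r * tGen F (π 0) := by
  have key : (Subalgebra.centralizer F {tGen F (π 0)}).comap η = ⊤ := by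
    refine racah_subalgebra_eq_top _ ?_ ?_ ?_ <;>
      rw [Subalgebra.mem_comap, Subalgebra.mem_centralizer_iff] <;> rintro _ rfl
    · rw [h.map_A]
      exact commute_quarter _ _ (dahaSqCentral F _ _) (dahaSqCentral F _ _)
    · rw [h.map_B]
      exact commute_quarter _ _ (dahaSqCentral F _ _) (dahaSqCentral F _ _)
    · rw [h.map_C]
      exact commute_quarter _ _ (dahaSqCentral F _ _) (dahaSqCentral F _ _)
  have : r ∈ (Subalgebra.centralizer F {tGen F (π 0)}).comap η := key ▸ Algebra.mem_top
  rw [Subalgebra.mem_comap, Subalgebra.mem_centralizer_iff] at this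
  exact this _ rfl

theorem last_smul {F V : Type} [Field F] [AddCommGroup V] [Module (DAHAAlg F) V]
    (π : Equiv.Perm (Fin 4)) (v : V) :
    tGen F (π 3) • v =
      -(v + tGen F (π 0) • v + tGen F (π 1) • v + tGen F (π 2) • v) := by
  have h : tGen F (π 3) = -(1 + tGen F (π 0) + tGen F (π 1) + tGen F (π 2)) := by
    rw [← neg_eq_iff_eq_neg.2 (dahaSum_perm (F := F) π)]
    abel
  rw [h, neg_smul, add_smul, add_smul, add_smul, one_smul]

theorem tGen_smul_comm {F V : Type} [Field F] [AddCommGroup V] [Module F V]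
    [Module (DAHAAlg F) V] [IsScalarTower F (DAHAAlg F) V] (i : Fin 4) (r : F) (v : V) :
    tGen F i • r • v = r • tGen F i • v :=
  (Algebra.lsmul F F V (tGen F i)).map_smul r v

/-- The operators `P ^ 2 = 4 A + 1` and `Q ^ 2 = 4 B + 1` are bidiagonal on the sequence `x`, which
vanishes beyond `n`, with the coefficients of `R_n(a,b,c)`. -/
structure IsBidiagonal {F V : Type} [Field F] [AddCommGroup V] [Module F V] (P Q : Module.End F V)
    (a b c : F) (n : ℕ) (x : ℕ → V) : Prop where
  last : x (n + 1) = 0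
  P_sq : ∀ k, P (P (x k)) = (4 * thP F a n k + 1) • x k + x (k + 1)
  Q_sq : ∀ k, Q (Q (x k)) = (4 * thP F b n k + 1) • x k + (16 * phP F a b c n k) • x (k - 1)

/-- The action of `tᵢ` on a `𝔥`-module. -/
def tEnd (F V : Type) [Field F] [AddCommGroup V] [Module F V] [Module (DAHAAlg F) V]
    [IsScalarTower F (DAHAAlg F) V] (i : Fin 4) : Module.End F V :=
  Algebra.lsmul F F V (tGen F i)

theorem tEnd_add_apply {F V : Type} [Field F] [AddCommGroup V] [Module F V] [Module (DAHAAlg F) V]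
    [IsScalarTower F (DAHAAlg F) V] (i j : Fin 4) (v : V) :
    (tEnd F V i + tEnd F V j) v = (tGen F i + tGen F j) • v :=
  (add_smul _ _ _).symm

section Factors

variable {F V : Type} [Field F] [CharZero F] [AddCommGroup V] [Module F V]
  [Module (DAHAAlg F) V] [IsScalarTower F (DAHAAlg F) V]
  [Module (RacahAlg F) V]
  {η : RacahAlg F →ₐ[F] DAHAAlg F} {π : Equiv.Perm (Fin 4)}

theorem IsZetaTwist.delta_smul (hη : ∀ (r : RacahAlg F) (v : V), r • v = η r • v)
    (hπ : IsZetaTwist π η) {κ : Fin 4 → F} (hκ : ∀ i (v : V), tGen F i • tGen F i • v = κ i • v)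
    {e : F} (he : κ (π 0) = e ^ 2) {v : V} (hv : tGen F (π 0) • v = e • v) :
    rDelta F • v = ((κ (π 0) + κ (π 1) + κ (π 2) + κ (π 3) - 2 * e - 3) / 4) • v := by
  have h0 := congrArg (tGen F (π 0) • ·) (last_smul (F := F) π v)
  have h1 := last_smul (F := F) π (tGen F (π 0) • v)
  simp only [smul_add, smul_neg, hv, tGen_smul_comm] at h0 h1
  rw [rDelta, add_smul, add_smul, hη, hη, hη, hπ.map_A, hπ.map_B, hπ.map_C, quarter_smul,
    quarter_smul, quarter_smul]
  simp only [add_smul, smul_add, hκ, hv, tGen_smul_comm]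
  rw [h0, h1, he]
  obtain ⟨T, hT⟩ : ∃ T : Fin 4 → V → V, ∀ i v, tGen F i • v = T i v := ⟨_, fun _ _ => rfl⟩
  simp only [hT]
  module

variable [IsScalarTower F (RacahAlg F) V]

/-- Nonzero `ℜ`-submodules of an eigenspace of `t` contain the image of the complementary
projection. -/
theorem IsZetaTwist.add_smul_mem [IsSimpleModule (DAHAAlg F) V]
    (hη : ∀ (r : RacahAlg F) (v : V), r • v = η r • v) (hπ : IsZetaTwist π η) {κ : Fin 4 → F}
    (hκ : ∀ i (v : V), tGen F i • tGen F i • v = κ i • v) {e : F} (he : κ (π 0) = e ^ 2)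
    (U : Submodule (RacahAlg F) V) (hU : U ≠ ⊥) (hUe : ∀ u ∈ U, tGen F (π 0) • u = e • u) (v : V) :
    tGen F (π 0) • v + e • v ∈ U := by
  let T : Fin 4 → Module.End F V := fun i => Algebra.lsmul F F V (tGen F (π i))
  have hT : ∀ i (u : V), T i u = tGen F (π i) • u := fun _ _ => rfl
  have hmem : ∀ (r : F), ∀ u ∈ U, r • u ∈ U := fun r u hu => U.smul_of_tower_mem r hu
  have anti : ∀ (i : Fin 4) (r : RacahAlg F), η r = (1 / 4 : F) •
      ((tGen F (π 0) + tGen F (π i) - 1) * (tGen F (π 0) + tGen F (π i) + 1)) →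
      ∀ u ∈ U, T 0 (T i u) + T i (T 0 u) ∈ U := fun i r hr u hu => by
    have h : T 0 (T i u) + T i (T 0 u) = (4 : F) • (r • u) + (1 - κ (π 0) - κ (π i)) • u := by
      rw [hη, hr, quarter_smul]
      simp only [hT, add_smul, smul_add, hκ]
      obtain ⟨T', hT'⟩ : ∃ T' : Fin 4 → V → V, ∀ i v, tGen F i • v = T' i v := ⟨_, fun _ _ => rfl⟩
      simp only [hT']
      module
    rw [h]
    exact add_mem (hmem _ _ (U.smul_mem _ hu)) (hmem _ _ hu)
  refine add_smul_mem_of_stable (T 0) (T 1) (T 2) e (κ (π 1)) (κ (π 2)) (κ (π 3))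
    (fun v => ?_) (fun v => hκ _ v) (fun v => hκ _ v) (fun v => ?_) (fun W h0 h1 h2 => ?_)
    (U.restrictScalars F) (fun h => hU ?_) hUe (anti 1 _ hπ.map_A) (anti 2 _ hπ.map_B) v
  · rw [← he]; exact hκ _ v
  · have h : ∀ u : V, (1 + T 0 + T 1 + T 2) u = -(tGen F (π 3) • u) := fun u => by
      rw [last_smul (F := F) π u, neg_neg]; rfl
    rw [h, h, smul_neg, neg_neg, hκ]
  · refine eq_bot_or_eq_top_of_tGen_stable W fun i w hw => ?_
    have h3 : tGen F (π 3) • w ∈ W := by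
      rw [last_smul (F := F) π w]
      exact neg_mem (add_mem (add_mem (add_mem hw (h0 w hw)) (h1 w hw)) (h2 w hw))
    have hall : ∀ j : Fin 4, tGen F (π j) • w ∈ W := by
      intro j
      fin_cases j
      exacts [h0 w hw, h1 w hw, h2 w hw, h3]
    simpa using hall (π.symm i)
  · exact (Submodule.restrictScalars_eq_bot_iff _ _ _).1 h

/-- A submodule of an eigenspace of `t` carrying a bidiagonal basis is simple and a copy of
`R_n(a,b,c)`. -/
theorem IsZetaTwist.simple_and_isRdModule [IsSimpleModule (DAHAAlg F) V]
    (hη : ∀ (r : RacahAlg F) (v : V), r • v = η r • v) (hπ : IsZetaTwist π η) {κ : Fin 4 → F}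
    (hκ : ∀ i (v : V), tGen F i • tGen F i • v = κ i • v) {e : F} (he : κ (π 0) = e ^ 2)
    (N : Submodule (RacahAlg F) V) (hN : ∀ v ∈ N, tGen F (π 0) • v = e • v)
    (hN' : ∀ v ∈ N, ∃ u, tGen F (π 0) • u + e • u = v)
    {a b c : F} {n : ℕ} {x : ℕ → V} (hx : ∀ k ≤ n, x k ∈ N)
    (hli : LinearIndependent F fun k : Fin (n + 1) => x k) (hfin : Module.finrank F N = n + 1)
    (hxb : IsBidiagonal (tEnd F V (π 0) + tEnd F V (π 1)) (tEnd F V (π 0) + tEnd F V (π 2))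
      a b c n x)
    (hδ : (κ (π 0) + κ (π 1) + κ (π 2) + κ (π 3) - 2 * e - 3) / 4 =
      (n : F) / 2 * ((n : F) / 2 + 1) + a * (a + 1) + b * (b + 1) + c * (c + 1)) :
    IsSimpleModule (RacahAlg F) N ∧ IsRdModule F a b c n N := by
  have h4 : (4 : F) ≠ 0 := by norm_num
  constructor
  · rw [isSimpleModule_iff_isAtom]
    refine ⟨fun h => ?_, fun U hU => ?_⟩
    · have h0 : x 0 = 0 := by simpa [h] using hx 0 (Nat.zero_le n)
      exact hli.ne_zero (0 : Fin (n + 1)) h0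
    · by_contra hU0
      refine hU.not_ge fun v hv => ?_
      obtain ⟨u, rfl⟩ := hN' v hv
      exact hπ.add_smul_mem hη hκ he U hU0 (fun u hu => hN u (hU.le hu)) u
  · refine isRdModule_of_bidiagonal N a b c n x hx hli hfin hxb.last (fun k _ => ?_) (fun k _ => ?_)
      fun u hu => ?_
    · rw [hη, hπ.map_A, quarter_smul, ← tEnd_add_apply, ← tEnd_add_apply, hxb.P_sq]
      match_scalars <;> field_simp
      ring
    · rw [hη, hπ.map_B, quarter_smul, ← tEnd_add_apply, ← tEnd_add_apply, hxb.Q_sq]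
      match_scalars <;> field_simp <;> ring
    · rw [hπ.delta_smul hη hκ he (hN u hu), hδ]

/-- The `ℜ`-endomorphism `t - e`. -/
def IsZetaTwist.shift (hη : ∀ (r : RacahAlg F) (v : V), r • v = η r • v) (hπ : IsZetaTwist π η)
    (e : F) : V →ₗ[RacahAlg F] V where
  toFun v := tGen F (π 0) • v - e • v
  map_add' u v := by rw [smul_add, smul_add]; abel
  map_smul' r v := by
    have h : e • r • v = r • e • v := by
      rw [← algebraMap_smul (RacahAlg F) e v, ← mul_smul, ← Algebra.commutes, mul_smul,
        algebraMap_smul]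
    rw [RingHom.id_apply, smul_sub, h, hη r (tGen F (π 0) • v), ← mul_smul, ← hπ.commute, mul_smul,
      ← hη r v]

theorem IsZetaTwist.composition_factors [IsSimpleModule (DAHAAlg F) V] [FiniteDimensional F V]
    (hη : ∀ (r : RacahAlg F) (v : V), r • v = η r • v) (hπ : IsZetaTwist π η) {κ : Fin 4 → F}
    (hκ : ∀ i (v : V), tGen F i • tGen F i • v = κ i • v) (e : F) (he : κ (π 0) = e ^ 2)
    {n m : ℕ} (hV : Module.finrank F V = n + 1 + (m + 1)) (hnm : e = 0 → n = m)
    {a b c a' b' c' : F} (x y : ℕ → V) (hx : ∀ k ≤ n, tGen F (π 0) • x k = e • x k)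
    (hy : ∀ k ≤ m, ∃ z, tGen F (π 0) • z - e • z = y k)
    (hxli : LinearIndependent F fun k : Fin (n + 1) => x k)
    (hyli : LinearIndependent F fun k : Fin (m + 1) => y k)
    (hxb : IsBidiagonal (tEnd F V (π 0) + tEnd F V (π 1)) (tEnd F V (π 0) + tEnd F V (π 2))
      a b c n x)
    (hyb : IsBidiagonal (tEnd F V (π 0) + tEnd F V (π 1)) (tEnd F V (π 0) + tEnd F V (π 2))
      a' b' c' m y)
    (hxδ : (κ (π 0) + κ (π 1) + κ (π 2) + κ (π 3) - 2 * e - 3) / 4 =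
      (n : F) / 2 * ((n : F) / 2 + 1) + a * (a + 1) + b * (b + 1) + c * (c + 1))
    (hyδ : (κ (π 0) + κ (π 1) + κ (π 2) + κ (π 3) - 2 * -e - 3) / 4 =
      (m : F) / 2 * ((m : F) / 2 + 1) + a' * (a' + 1) + b' * (b' + 1) + c' * (c' + 1))
    (s : CompositionSeries (Submodule (RacahAlg F) V)) (hs₀ : s.head = ⊥) (hs₁ : s.last = ⊤) :
    s.length = 2 ∧ ∃ i j : Fin s.length, i ≠ j ∧
      IsRdModule F a b c n (csFactor s i) ∧ IsRdModule F a' b' c' m (csFactor s j) := by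
  let f := hπ.shift hη e
  have hf : ∀ v, f v = tGen F (π 0) • v - e • v := fun _ => rfl
  have hx' : ∀ k ≤ n, x k ∈ LinearMap.ker f := fun k hk => by
    rw [LinearMap.mem_ker, hf, hx k hk, sub_self]
  obtain ⟨hker, hran⟩ := finrank_ker_range_of_linearIndependent f x y hx' hy hxli hyli hV
  have hk : ∀ v ∈ LinearMap.ker f, tGen F (π 0) • v = e • v := fun v hv => sub_eq_zero.1 hv
  have hr : ∀ v ∈ LinearMap.range f, tGen F (π 0) • v = -e • v := by
    rintro _ ⟨u, rfl⟩
    rw [hf, smul_sub, hκ, he, tGen_smul_comm]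
    obtain ⟨T, hT⟩ : ∃ T : Fin 4 → V → V, ∀ i v, tGen F i • v = T i v := ⟨_, fun _ _ => rfl⟩
    simp only [hT]
    module
  obtain ⟨hs, hR⟩ := hπ.simple_and_isRdModule hη hκ he (LinearMap.ker f) hk (fun v hv => by
    rcases eq_or_ne e 0 with h0 | h0
    · obtain ⟨u, hu⟩ := mem_range_of_sq_eq_zero (F := F) f (fun v => by
        rw [hf (f v), hr _ ⟨v, rfl⟩, h0]; simp) (by rw [hker, hran, hnm h0]) hv
      exact ⟨u, by rw [← hu, hf, h0]; simp⟩
    · refine ⟨(2 * e)⁻¹ • v, ?_⟩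
      rw [tGen_smul_comm, hk v hv, smul_comm, ← smul_add, ← add_smul, smul_smul]
      convert one_smul F v using 2
      field_simp
      norm_num) hx' hxli hker hxb hxδ
  obtain ⟨hs', hR'⟩ := hπ.simple_and_isRdModule hη hκ (e := -e) (by rw [he, neg_sq])
    (LinearMap.range f) hr (fun v ⟨u, hu⟩ => ⟨u, by rw [← hu, hf, neg_smul, sub_eq_add_neg]⟩) hy
    hyli hran hyb hyδ
  obtain ⟨hlen, i, j, hij, ⟨g⟩, ⟨g'⟩⟩ := compositionSeries_of_simple_ker_range f s hs₀ hs₁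
  exact ⟨hlen, i, j, hij, hR.congr g, hR'.congr g'⟩

end Factors

theorem linearIndependent_of_triangular {F V ι : Type} [Field F] [AddCommGroup V] [Module F V]
    [Fintype ι] (x : ι → V) (r : ι → ℕ)
    (h : ∀ k, ∃ f : V →ₗ[F] F, f (x k) ≠ 0 ∧ ∀ l ≠ k, r k ≤ r l → f (x l) = 0) :
    LinearIndependent F x := by
  rw [Fintype.linearIndependent_iff]
  intro g hg
  have key : ∀ (n : ℕ) (k : ι), r k = n → g k = 0 := fun n => by
    induction n using Nat.strong_induction_on with
    | _ n ih =>
      rintro k rfl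
      obtain ⟨f, hk, hf⟩ := h k
      have hs := congrArg f hg
      rw [map_sum, map_zero, Finset.sum_eq_single k] at hs
      · rw [map_smul, smul_eq_mul] at hs
        exact (mul_eq_zero.1 hs).resolve_right hk
      · intro l _ hl
        rw [map_smul, smul_eq_mul]
        rcases le_or_gt (r k) (r l) with hle | hlt
        · rw [hf l hl hle, mul_zero]
        · rw [ih _ hlt l rfl, zero_mul]
      · simp
  exact fun k => key _ k rfl

/-- The operators `t` act on the even-indexed basis vectors `u k = w (2 * k)` and the odd-indexed
ones `p (k + 1) = w (2 * k + 1)` as `t₀, t₁, t₂, t₃` do on `E_{2m+1}(a,b,c)`. -/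
structure IsEdSeq {F V : Type} [Field F] [AddCommGroup V] [Module F V]
    (t : Fin 4 → Module.End F V) (a b c : F) (m : ℕ) (u p : ℕ → V) : Prop where
  p_zero : p 0 = 0
  u_eq_zero : ∀ k, m < k → u k = 0
  p_eq_zero : ∀ k, m < k → p (k + 1) = 0
  t0u : ∀ k, t 0 (u k) = (4 * k * (m + 1 - k) : F) • p k - (m + 1 - 2 * k : F) • u k
  t0p : ∀ k, t 0 (p (k + 1)) = (m - 2 * k - 1 : F) • p (k + 1) + u (k + 1)
  t1u : ∀ k, t 1 (u k) = -(4 * k * (m + 1 - k) : F) • p k + a • u k + p (k + 1)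
  t1p : ∀ k, t 1 (p (k + 1)) = -a • p (k + 1)
  t2u : ∀ k, t 2 (u k) = b • u k
  t2p : ∀ k, t 2 (p (k + 1)) = -((a + b - m + 2 * k) ^ 2 - c ^ 2) • u k - b • p (k + 1) - u (k + 1)
  t3u : ∀ k, t 3 (u k) = -(a + b - m + 2 * k) • u k - p (k + 1)
  t3p : ∀ k, t 3 (p (k + 1)) =
    ((a + b - m + 2 * k) ^ 2 - c ^ 2) • u k + (a + b - m + 2 * k) • p (k + 1)
  eq_top : ∀ W : Submodule F V, (∀ k, u k ∈ W) → (∀ k, p (k + 1) ∈ W) → W = ⊤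
  exists_dual_u : ∀ k ≤ m, ∃ f : V →ₗ[F] F, (∀ l, f (u l) = if l = k then 1 else 0) ∧
    ∀ l, f (p l) = 0
  exists_dual_p : ∀ k ≤ m, ∃ f : V →ₗ[F] F, (∀ l, f (p l) = if l = k + 1 then 1 else 0) ∧
    ∀ l, f (u l) = 0

namespace IsEdSeq

variable {F V : Type} [Field F] [CharZero F] [AddCommGroup V] [Module F V]
  {t : Fin 4 → Module.End F V} {a b c : F} {m : ℕ} {u p : ℕ → V}

theorem sq_apply (H : IsEdSeq t a b c m u p) (i : Fin 4) (v : V) :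
    t i (t i v) = (![((m : F) + 1) ^ 2, a ^ 2, b ^ 2, c ^ 2] i) • v := by
  let W : Submodule F V := LinearMap.ker
    (t i * t i - (![((m : F) + 1) ^ 2, a ^ 2, b ^ 2, c ^ 2] i) • (1 : Module.End F V))
  have hW : ∀ v, v ∈ W ↔ t i (t i v) = (![((m : F) + 1) ^ 2, a ^ 2, b ^ 2, c ^ 2] i) • v := by
    intro v
    rw [LinearMap.mem_ker, LinearMap.sub_apply, sub_eq_zero]
    rfl
  have h : W = ⊤ := by
    refine H.eq_top W (fun k => (hW _).2 ?_) (fun k => (hW _).2 ?_)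
    · obtain _ | k := k <;> fin_cases i <;>
        simp [H.t0u, H.t0p, H.t1u, H.t1p, H.t2u, H.t3u, H.t3p, H.p_zero] <;> module
    · fin_cases i <;> simp [H.t0u, H.t0p, H.t1p, H.t2u, H.t2p, H.t3u, H.t3p] <;> module
  exact (hW v).1 (h ▸ Submodule.mem_top)

theorem bidiagonal_t₀_ker (H : IsEdSeq t a b c m u p) :
    IsBidiagonal (t 0 + t 1) (t 0 + t 2) (-(a + 1) / 2) (-(b + 1) / 2) (-(c + 1) / 2) (m + 1)
      fun k => u k - (2 * k : F) • p k where
  last := by simp [H.u_eq_zero, H.p_eq_zero]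
  P_sq k := by
    obtain _ | k := k <;>
      simp only [thP, LinearMap.add_apply, map_add, map_sub, map_smul, H.t0u, H.t0p, H.t1u, H.t1p,
        H.p_zero, map_zero] <;>
      push_cast <;> module
  Q_sq k := by
    obtain _ | _ | k := k <;>
      simp only [thP, phP, LinearMap.add_apply, map_add, map_sub, map_smul, H.t0u, H.t0p, H.t2u,
        H.t2p, H.p_zero, map_zero, Nat.add_sub_cancel] <;>
      push_cast <;> module

theorem bidiagonal_t₀_range (H : IsEdSeq t a b c (m + 1) u p) :
    IsBidiagonal (t 0 + t 1) (t 0 + t 2) (-(a + 1) / 2) (-(b + 1) / 2) (-(c + 1) / 2) m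
      fun k => u (k + 1) + (2 * (m + 1 - k) : F) • p (k + 1) where
  last := by simp [H.u_eq_zero]
  P_sq k := by
    simp only [thP, LinearMap.add_apply, map_add, map_sub, map_smul, H.t0u, H.t0p, H.t1u, H.t1p]
    push_cast
    module
  Q_sq k := by
    obtain _ | _ | k := k <;>
      simp only [thP, phP, LinearMap.add_apply, map_add, map_sub, map_smul, H.t0u, H.t0p, H.t2u,
        H.t2p, H.p_zero, Nat.add_sub_cancel] <;>
      push_cast <;> module

theorem bidiagonal_t₁_ker (H : IsEdSeq t a b c m u p) :
    IsBidiagonal (t 1 + t 0) (t 1 + t 3) (-a / 2 - 1) (-(b + 1) / 2) (-(c + 1) / 2) m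
      fun k => p (k + 1) where
  last := by simp [H.p_eq_zero]
  P_sq k := by
    simp only [thP, LinearMap.add_apply, map_add, map_smul, H.t1u, H.t1p, H.t0u, H.t0p]
    push_cast
    module
  Q_sq k := by
    obtain _ | _ | k := k <;>
      simp only [thP, phP, LinearMap.add_apply, map_add, map_smul, H.t1u, H.t1p, H.t3u, H.t3p,
        H.p_zero, Nat.add_sub_cancel] <;>
      push_cast <;> module

theorem bidiagonal_t₁_range (H : IsEdSeq t a b c m u p) :
    IsBidiagonal (t 1 + t 0) (t 1 + t 3) (-a / 2) (-(b + 1) / 2) (-(c + 1) / 2) m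
      fun k => (2 * a) • u k + p (k + 1) - (4 * k * (m + 1 - k) : F) • p k where
  last := by simp [H.u_eq_zero, H.p_eq_zero]
  P_sq k := by
    obtain _ | k := k <;>
      simp only [thP, LinearMap.add_apply, map_add, map_sub, map_smul, H.t1u, H.t1p, H.t0u, H.t0p,
        H.p_zero, map_zero] <;>
      push_cast <;> module
  Q_sq k := by
    obtain _ | _ | k := k <;>
      simp only [thP, phP, LinearMap.add_apply, map_add, map_sub, map_smul, H.t1u, H.t1p, H.t3u,
        H.t3p, H.p_zero, map_zero, Nat.add_sub_cancel] <;>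
      push_cast <;> module

theorem bidiagonal_t₂_ker (H : IsEdSeq t a b c m u p) :
    IsBidiagonal (t 2 + t 3) (t 2 + t 0) (-(a + 1) / 2) (-b / 2) (-(c + 1) / 2) m
      fun k => u k where
  last := by simp [H.u_eq_zero]
  P_sq k := by
    simp only [thP, LinearMap.add_apply, map_add, map_sub, map_smul, H.t2u, H.t2p, H.t3u, H.t3p]
    module
  Q_sq k := by
    obtain _ | _ | k := k <;>
      simp only [thP, phP, LinearMap.add_apply, map_add, map_sub, map_smul, H.t2u, H.t2p, H.t0u,
        H.t0p, H.p_zero, map_zero, Nat.add_sub_cancel] <;>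
      push_cast <;> module

theorem bidiagonal_t₂_range (H : IsEdSeq t a b c m u p) :
    IsBidiagonal (t 2 + t 3) (t 2 + t 0) (-(a + 1) / 2) (-b / 2 - 1) (-(c + 1) / 2) m
      fun k => -((a + b - m + 2 * k) ^ 2 - c ^ 2) • u k - (2 * b) • p (k + 1) - u (k + 1) where
  last := by simp [H.u_eq_zero, H.p_eq_zero]
  P_sq k := by
    simp only [thP, LinearMap.add_apply, map_add, map_sub, map_smul, H.t2u, H.t2p, H.t3u, H.t3p]
    push_cast
    module
  Q_sq k := by
    obtain _ | _ | k := k <;>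
      simp only [thP, phP, LinearMap.add_apply, map_add, map_sub, map_smul, H.t2u, H.t2p, H.t0u,
        H.t0p, H.p_zero, map_zero, Nat.add_sub_cancel] <;>
      push_cast <;> module

theorem bidiagonal_t₃_ker (H : IsEdSeq t a b c m u p) :
    IsBidiagonal (t 3 + t 2) (t 3 + t 1) (-(a + 1) / 2) (-(b + 1) / 2) (-c / 2) m
      fun k => p (k + 1) + (a + b - m + 2 * k - c) • u k where
  last := by simp [H.u_eq_zero, H.p_eq_zero]
  P_sq k := by
    simp only [thP, LinearMap.add_apply, map_add, map_sub, map_smul, H.t3u, H.t3p, H.t2u, H.t2p]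
    push_cast
    module
  Q_sq k := by
    obtain _ | _ | k := k <;>
      simp only [thP, phP, LinearMap.add_apply, map_add, map_sub, map_smul, H.t3u, H.t3p, H.t1u,
        H.t1p, H.p_zero, map_zero, Nat.add_sub_cancel] <;>
      push_cast <;> module

theorem bidiagonal_t₃_range (H : IsEdSeq t a b c m u p) :
    IsBidiagonal (t 3 + t 2) (t 3 + t 1) (-(a + 1) / 2) (-(b + 1) / 2) (-c / 2 - 1) m
      fun k => p (k + 1) + (a + b - m + 2 * k + c) • u k where
  last := by simp [H.u_eq_zero, H.p_eq_zero]
  P_sq k := by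
    simp only [thP, LinearMap.add_apply, map_add, map_sub, map_smul, H.t3u, H.t3p, H.t2u, H.t2p]
    push_cast
    module
  Q_sq k := by
    obtain _ | _ | k := k <;>
      simp only [thP, phP, LinearMap.add_apply, map_add, map_sub, map_smul, H.t3u, H.t3p, H.t1u,
        H.t1p, H.p_zero, map_zero, Nat.add_sub_cancel] <;>
      push_cast <;> module

end IsEdSeq

namespace IsEdSeq

variable {F V : Type} [Field F] [AddCommGroup V] [Module F V]
  {t : Fin 4 → Module.End F V} {a b c : F} {m : ℕ} {u p : ℕ → V}

theorem coeff_ne_zero (H : IsEdSeq t a b c m u p)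
    (hirr : ∀ W : Submodule F V, (∀ i, ∀ w ∈ W, t i w ∈ W) → W = ⊥ ∨ W = ⊤) {k : ℕ} (hk : k ≤ m) :
    (a + b - m + 2 * k) ^ 2 - c ^ 2 ≠ 0 := by
  intro h0
  let W : Submodule F V := Submodule.span F
    ({v | ∃ j, k ≤ j ∧ p (j + 1) = v} ∪ {v | ∃ j, k ≤ j ∧ u (j + 1) = v})
  have hp : ∀ j, k ≤ j → p (j + 1) ∈ W := fun j hj => Submodule.subset_span (Or.inl ⟨j, hj, rfl⟩)
  have hu : ∀ j, k ≤ j → u (j + 1) ∈ W := fun j hj => Submodule.subset_span (Or.inr ⟨j, hj, rfl⟩)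
  have hle : ∀ W' : Submodule F V, (∀ j, k ≤ j → p (j + 1) ∈ W') → (∀ j, k ≤ j → u (j + 1) ∈ W') →
      W ≤ W' := by
    intro W' h h'
    rw [Submodule.span_le]
    rintro _ (⟨j, hj, rfl⟩ | ⟨j, hj, rfl⟩)
    exacts [h j hj, h' j hj]
  have hcu : ∀ j, k ≤ j → ((a + b - m + 2 * j) ^ 2 - c ^ 2) • u j ∈ W := by
    intro j hj
    rcases hj.eq_or_lt with rfl | hj
    · rw [h0, zero_smul]
      exact W.zero_mem
    · obtain ⟨j, rfl⟩ := Nat.exists_eq_succ_of_ne_zero (Nat.ne_zero_of_lt hj)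
      exact W.smul_mem _ (hu j (Nat.lt_succ_iff.1 hj))
  have hstab : ∀ i, W ≤ W.comap (t i) := by
    intro i
    refine hle _ (fun j hj => ?_) (fun j hj => ?_) <;> rw [Submodule.mem_comap] <;> fin_cases i
    · simpa only [Fin.zero_eta, H.t0p] using add_mem (W.smul_mem _ (hp j hj)) (hu j hj)
    · simpa only [Fin.mk_one, H.t1p] using W.smul_mem _ (hp j hj)
    · simpa only [Fin.reduceFinMk, H.t2p, neg_smul] using
        sub_mem (sub_mem (neg_mem (hcu j hj)) (W.smul_mem _ (hp j hj))) (hu j hj)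
    · simpa only [Fin.reduceFinMk, H.t3p] using add_mem (hcu j hj) (W.smul_mem _ (hp j hj))
    · simpa only [Fin.zero_eta, H.t0u] using
        sub_mem (W.smul_mem _ (hp j hj)) (W.smul_mem _ (hu j hj))
    · simpa only [Fin.mk_one, H.t1u] using
        add_mem (add_mem (W.smul_mem _ (hp j hj)) (W.smul_mem _ (hu j hj))) (hp (j + 1) (by omega))
    · simpa only [Fin.reduceFinMk, H.t2u] using W.smul_mem _ (hu j hj)
    · simpa only [Fin.reduceFinMk, H.t3u] using
        sub_mem (W.smul_mem _ (hu j hj)) (hp (j + 1) (by omega))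
  rcases hirr W hstab with h | h
  · obtain ⟨f, hf, -⟩ := H.exists_dual_p k hk
    have h1 : p (k + 1) = 0 := by simpa [h] using hp k le_rfl
    have := hf (k + 1)
    simp [h1] at this
  · obtain ⟨f, hf, hf'⟩ := H.exists_dual_u k hk
    have hker : W ≤ LinearMap.ker f := hle _ (fun j _ => hf' _) fun j hj => by
      rw [LinearMap.mem_ker, hf, if_neg (by omega)]
    have h1 : u k ∈ LinearMap.ker f := hker (h ▸ Submodule.mem_top)
    rw [LinearMap.mem_ker, hf, if_pos rfl] at h1
    exact one_ne_zero h1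

theorem linearIndependent_t₀_ker [CharZero F] (H : IsEdSeq t a b c m u p) :
    LinearIndependent F fun k : Fin (m + 1 + 1) => u k - (2 * (k : ℕ) : F) • p k := by
  refine linearIndependent_of_triangular _ (fun _ => 0) fun k => ?_
  obtain ⟨_ | k, hk⟩ := k
  · obtain ⟨f, hf, hf'⟩ := H.exists_dual_u 0 (Nat.zero_le m)
    refine ⟨f, by simp [hf], fun l hl _ => ?_⟩
    have : (l : ℕ) ≠ 0 := fun h => hl (Fin.ext h)
    simp [hf, hf', this]
  · obtain ⟨f, hf, hf'⟩ := H.exists_dual_p k (by omega)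
    refine ⟨f, ?_, fun l hl _ => ?_⟩
    · simpa [hf, hf'] using Nat.cast_add_one_ne_zero k
    · have : (l : ℕ) ≠ k + 1 := fun h => hl (Fin.ext h)
      simp [hf, hf', this]

theorem linearIndependent_t₀_range (H : IsEdSeq t a b c (m + 1) u p) :
    LinearIndependent F fun k : Fin (m + 1) =>
      u (k + 1) + (2 * (m + 1 - (k : ℕ)) : F) • p (k + 1) := by
  refine linearIndependent_of_triangular _ (fun _ => 0) fun k => ?_
  obtain ⟨f, hf, hf'⟩ := H.exists_dual_u (k + 1) (by omega)
  refine ⟨f, by simp [hf, hf'], fun l hl _ => ?_⟩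
  have : (l : ℕ) ≠ k := fun h => hl (Fin.ext h)
  simp [hf, hf', this]

theorem linearIndependent_t₁_ker (H : IsEdSeq t a b c m u p) :
    LinearIndependent F fun k : Fin (m + 1) => p (k + 1) := by
  refine linearIndependent_of_triangular _ (fun _ => 0) fun k => ?_
  obtain ⟨f, hf, hf'⟩ := H.exists_dual_p k (by omega)
  refine ⟨f, by simp [hf], fun l hl _ => ?_⟩
  have : (l : ℕ) ≠ k := fun h => hl (Fin.ext h)
  simp [hf, this]

theorem linearIndependent_t₁_range (H : IsEdSeq t a b c m u p) :
    LinearIndependent F fun k : Fin (m + 1) =>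
      (2 * a) • u k + p (k + 1) - (4 * (k : ℕ) * (m + 1 - (k : ℕ)) : F) • p k := by
  refine linearIndependent_of_triangular _ (fun k => m - k) fun k => ?_
  obtain ⟨f, hf, hf'⟩ := H.exists_dual_p k (by omega)
  refine ⟨f, by simp [hf, hf'], fun l hl hkl => ?_⟩
  have h1 : (l : ℕ) ≠ k := fun h => hl (Fin.ext h)
  have h2 : (l : ℕ) ≠ k + 1 := by omega
  simp [hf, hf', h1, h2]

theorem linearIndependent_t₂_ker (H : IsEdSeq t a b c m u p) :
    LinearIndependent F fun k : Fin (m + 1) => u k := by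
  refine linearIndependent_of_triangular _ (fun _ => 0) fun k => ?_
  obtain ⟨f, hf, hf'⟩ := H.exists_dual_u k (by omega)
  refine ⟨f, by simp [hf], fun l hl _ => ?_⟩
  have : (l : ℕ) ≠ k := fun h => hl (Fin.ext h)
  simp [hf, this]

theorem linearIndependent_t₂_range (H : IsEdSeq t a b c m u p)
    (hirr : ∀ W : Submodule F V, (∀ i, ∀ w ∈ W, t i w ∈ W) → W = ⊥ ∨ W = ⊤) :
    LinearIndependent F fun k : Fin (m + 1) =>
      -((a + b - m + 2 * (k : ℕ)) ^ 2 - c ^ 2) • u k - (2 * b) • p (k + 1) - u (k + 1) := by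
  refine linearIndependent_of_triangular _ (fun k => k) fun k => ?_
  obtain ⟨f, hf, hf'⟩ := H.exists_dual_u k (by omega)
  refine ⟨f, ?_, fun l hl hkl => ?_⟩
  · have := H.coeff_ne_zero hirr (k := k) (by omega)
    simp only [map_sub, map_smul, hf, hf', if_pos, if_neg (Nat.succ_ne_self _), smul_eq_mul,
      mul_one, mul_zero, sub_zero]
    exact neg_ne_zero.2 this
  · have h1 : (l : ℕ) ≠ k := fun h => hl (Fin.ext h)
    have h2 : (l : ℕ) + 1 ≠ k := by omega
    simp [hf, hf', h1, h2]

theorem linearIndependent_t₃ (H : IsEdSeq t a b c m u p) (e : ℕ → F) :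
    LinearIndependent F fun k : Fin (m + 1) => p (k + 1) + e k • u k := by
  refine linearIndependent_of_triangular _ (fun _ => 0) fun k => ?_
  obtain ⟨f, hf, hf'⟩ := H.exists_dual_p k (by omega)
  refine ⟨f, by simp [hf, hf'], fun l hl _ => ?_⟩
  have : (l : ℕ) ≠ k := fun h => hl (Fin.ext h)
  simp [hf, hf', this]

end IsEdSeq

theorem IsEdModule.exists_isEdSeq {F V : Type} [Field F] [CharZero F] [AddCommGroup V]
    [Module (DAHAAlg F) V] [Module F V] [IsScalarTower F (DAHAAlg F) V] {a b c : F} {m : ℕ}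
    (h : IsEdModule F a b c (2 * m + 1) V) :
    FiniteDimensional F V ∧ Module.finrank F V = m + 1 + (m + 1) ∧
      ∃ u p : ℕ → V, IsEdSeq (tEnd F V) a b c m u p := by
  have hF := resF_eq (F := F) (A := DAHAAlg F) (W := V)
  dsimp only [IsEdModule] at h
  rw [← hF] at h
  obtain ⟨v, w, hw, hw0, h0e, h0o, h00, h0d, h1e, h1o, h10, h2e, h2o, h2d, h3e, h3o⟩ := h
  have hwe : ∀ k, m < k → w (2 * k) = 0 := fun k hk => hw0 _ (by omega)
  have hwo : ∀ k, m < k → w (2 * k + 1) = 0 := fun k hk => hw0 _ (by omega)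
  have ht : ∀ i (x : V), tEnd F V i x = tGen F i • x := fun _ _ => rfl
  have hcoord : ∀ i ≤ 2 * m + 1, ∃ f : V →ₗ[F] F, ∀ l, f (w l) = if l = i then 1 else 0 := by
    intro i hi
    refine ⟨v.coord ⟨i, by omega⟩, fun l => ?_⟩
    rcases lt_or_ge l (2 * m + 1 + 1) with hl | hl
    · rw [show w l = v ⟨l, hl⟩ from hw ⟨l, hl⟩, Module.Basis.coord_apply, Module.Basis.repr_self,
        Finsupp.single_apply]
      simp
    · rw [hw0 l hl, map_zero, if_neg (by omega)]
  let p : ℕ → V := fun k => Nat.casesOn k 0 fun j => w (2 * j + 1)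
  have hp : ∀ k, p (k + 1) = w (2 * k + 1) := fun _ => rfl
  have hz : ∀ k, m < k → (4 * k * (m + 1 - k) : F) • p k = 0 := by
    intro k hk
    obtain rfl | hk' := (Nat.succ_le_of_lt hk).eq_or_lt
    · simp
    · obtain ⟨j, rfl⟩ : ∃ j, k = j + 1 := ⟨k - 1, by omega⟩
      rw [hp, hwo j (by omega), smul_zero]
  have hστ : ∀ k : ℕ, (sigP F a b c (2 * m + 1) + ((2 * k + 1 : ℕ) : F)) *
      (tauP F a b c (2 * m + 1) + ((2 * k + 1 : ℕ) : F)) = (a + b - m + 2 * k) ^ 2 - c ^ 2 := by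
    intro k
    rw [sigP, tauP]
    push_cast
    ring
  refine ⟨Module.Finite.of_basis v, ?_, fun k => w (2 * k), p, ?_⟩
  · rw [Module.finrank_eq_card_basis v, Fintype.card_fin]
    ring
  refine
    { p_zero := rfl
      u_eq_zero := hwe
      p_eq_zero := fun k hk => hwo k hk
      t0u := fun k => ?_
      t0p := fun k => ?_
      t1u := fun k => ?_
      t1p := fun k => ?_
      t2u := fun k => ?_
      t2p := fun k => ?_
      t3u := fun k => ?_
      t3p := fun k => ?_
      eq_top := fun W hu hpW => ?_
      exists_dual_u := fun k hk => ?_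
      exists_dual_p := fun k hk => ?_ }
  · rw [ht]
    rcases le_or_gt k m with hk | hk
    · obtain _ | k := k
      · rw [h00]
        simp
        module
      · rw [h0e (2 * (k + 1)) (even_two_mul _) (by omega) (by omega), hp,
          show 2 * (k + 1) - 1 = 2 * k + 1 by omega]
        push_cast
        module
    · rw [hz k hk, hwe k hk, smul_zero, smul_zero, sub_zero]
  · rw [ht, hp]
    rcases lt_trichotomy k m with hk | rfl | hk
    · rw [h0o (2 * k + 1) (odd_two_mul_add_one k) (by omega),
        show 2 * k + 1 + 1 = 2 * (k + 1) by ring]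
      push_cast
      module
    · rw [h0d, hwe (k + 1) (by omega)]
      push_cast
      module
    · simp [hwo k hk, hwe (k + 1) (by omega)]
  · rw [ht, hp]
    rcases le_or_gt k m with hk | hk
    · obtain _ | k := k
      · rw [h10]
        simp
      · rw [h1e (2 * (k + 1)) (even_two_mul _) (by omega) (by omega), hp,
          show 2 * (k + 1) - 1 = 2 * k + 1 by omega]
        push_cast
        module
    · rw [neg_smul, hz k hk, hwe k hk, hwo k hk, smul_zero, smul_zero, neg_zero, add_zero, add_zero]
  · rw [ht, hp]
    rcases le_or_gt k m with hk | hk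
    · exact h1o (2 * k + 1) (odd_two_mul_add_one k) (by omega)
    · rw [hwo k hk, smul_zero, smul_zero]
  · rw [ht]
    rcases le_or_gt k m with hk | hk
    · exact h2e (2 * k) (even_two_mul k) (by omega)
    · rw [hwe k hk, smul_zero, smul_zero]
  · rw [ht, hp, ← hστ]
    rcases lt_trichotomy k m with hk | rfl | hk
    · rw [h2o (2 * k + 1) (odd_two_mul_add_one k) (by omega),
        show 2 * k + 1 + 1 = 2 * (k + 1) by ring, Nat.add_sub_cancel]
    · rw [h2d, hwe (k + 1) (by omega), Nat.add_sub_cancel, sub_zero]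
    · simp [hwo k hk, hwe k hk, hwe (k + 1) (by omega)]
  · rw [ht, hp]
    rcases le_or_gt k m with hk | hk
    · rw [h3e (2 * k) (even_two_mul k) (by omega), sigP, tauP]
      push_cast
      module
    · simp [hwo k hk, hwe k hk]
  · rw [ht, hp, ← hστ]
    rcases le_or_gt k m with hk | hk
    · rw [h3o (2 * k + 1) (odd_two_mul_add_one k) (by omega), Nat.add_sub_cancel, sigP, tauP]
      push_cast
      module
    · simp [hwo k hk, hwe k hk]
  · rw [← top_le_iff, ← v.span_eq, Submodule.span_le]
    rintro _ ⟨i, rfl⟩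
    rw [← hw i]
    obtain ⟨k, hk | hk⟩ := Nat.even_or_odd' i
    · rw [hk]; exact hu k
    · rw [hk]; exact hpW k
  · obtain ⟨f, hf⟩ := hcoord (2 * k) (by omega)
    refine ⟨f, fun l => ?_, fun l => ?_⟩
    · rw [hf]
      exact if_congr (by omega) rfl rfl
    · obtain _ | l := l
      · exact map_zero f
      · rw [hp, hf, if_neg (by omega)]
  · obtain ⟨f, hf⟩ := hcoord (2 * k + 1) (by omega)
    refine ⟨f, fun l => ?_, fun l => ?_⟩
    · obtain _ | l := l
      · rw [if_neg (by omega)]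
        exact map_zero f
      · rw [hp, hf]
        exact if_congr (by omega) rfl rfl
    · rw [hf, if_neg (by omega)]

section Twists

variable {F V : Type} [Field F] [CharZero F] [AddCommGroup V] [Module F V]
  [Module (DAHAAlg F) V] [IsScalarTower F (DAHAAlg F) V] [Module (RacahAlg F) V]
  [IsScalarTower F (RacahAlg F) V] [IsSimpleModule (DAHAAlg F) V]
  {η : RacahAlg F →ₐ[F] DAHAAlg F} {π : Equiv.Perm (Fin 4)} {a b c : F} {m : ℕ} {u p : ℕ → V}

/-- The `ℜ`-module `E_1(a,b,c)`. -/
theorem IsZetaTwist.simple_and_isRdModule_one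
    (hη : ∀ (r : RacahAlg F) (v : V), r • v = η r • v) (hπ : IsZetaTwist π η)
    (h0 : π 0 = 0) (h1 : π 1 = 1) (h2 : π 2 = 2) (h3 : π 3 = 3)
    (H : IsEdSeq (tEnd F V) a b c 0 u p) (hV : Module.finrank F V = 1 + 1) :
    IsSimpleModule (RacahAlg F) V ∧
      IsRdModule F (-(a + 1) / 2) (-(b + 1) / 2) (-(c + 1) / 2) 1 V := by
  have ht : ∀ i (x : V), tGen F i • x = tEnd F V i x := fun _ _ => rfl
  have ht₀ : ∀ v : V, tGen F 0 • v = (-1 : F) • v := by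
    have h : LinearMap.ker (tEnd F V 0 - (-1 : F) • (1 : Module.End F V)) = ⊤ := by
      refine H.eq_top _ (fun k => ?_) (fun k => ?_) <;>
        rw [LinearMap.mem_ker, LinearMap.sub_apply, LinearMap.smul_apply, Module.End.one_apply]
      · obtain _ | k := k
        · simp [H.t0u]
        · simp [H.u_eq_zero]
      · obtain _ | k := k
        · simp [H.t0p, H.u_eq_zero]
        · simp [H.p_eq_zero]
    intro v
    have hv : v ∈ LinearMap.ker (tEnd F V 0 - (-1 : F) • (1 : Module.End F V)) :=
      h ▸ Submodule.mem_top
    exact sub_eq_zero.1 hv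
  have hb := H.bidiagonal_t₀_ker
  obtain ⟨hs, hR⟩ := hπ.simple_and_isRdModule hη H.sq_apply (e := -1)
    (a := -(a + 1) / 2) (b := -(b + 1) / 2) (c := -(c + 1) / 2) (n := 1)
    (x := fun k => u k - (2 * k : F) • p k) (by simp [h0]) ⊤
    (fun v _ => by rw [h0]; exact ht₀ v)
    (fun v _ => ⟨-(2 : F)⁻¹ • v, by
      rw [h0, ht₀]
      match_scalars
      norm_num⟩)
    (fun _ _ => Submodule.mem_top) H.linearIndependent_t₀_ker
    ((Submodule.topEquiv (R := RacahAlg F) (M := V)).restrictScalars F |>.finrank_eq.trans hV)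
    (by rw [h0, h1, h2]; exact hb) (by
      simp [h0, h1, h2, h3]
      ring)
  exact ⟨IsSimpleModule.congr (N := (⊤ : Submodule (RacahAlg F) V)) Submodule.topEquiv.symm,
    hR.congr Submodule.topEquiv⟩

variable [FiniteDimensional F V]

/-- The composition factors of `E_d(a,b,c)` for `d = 2 * m + 3`. -/
theorem IsZetaTwist.composition_factors_t₀
    (hη : ∀ (r : RacahAlg F) (v : V), r • v = η r • v) (hπ : IsZetaTwist π η)
    (h0 : π 0 = 0) (h1 : π 1 = 1) (h2 : π 2 = 2) (h3 : π 3 = 3)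
    (H : IsEdSeq (tEnd F V) a b c (m + 1) u p)
    (hV : Module.finrank F V = m + 1 + 1 + (m + 1 + 1))
    (s : CompositionSeries (Submodule (RacahAlg F) V)) (hs₀ : s.head = ⊥) (hs₁ : s.last = ⊤) :
    s.length = 2 ∧ ∃ i j : Fin s.length, i ≠ j ∧
      IsRdModule F (-(a + 1) / 2) (-(b + 1) / 2) (-(c + 1) / 2) (m + 2) (csFactor s i) ∧
      IsRdModule F (-(a + 1) / 2) (-(b + 1) / 2) (-(c + 1) / 2) m (csFactor s j) := by
  have ht : ∀ i (x : V), tGen F i • x = tEnd F V i x := fun _ _ => rfl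
  refine hπ.composition_factors hη H.sq_apply (-((m : F) + 2)) ?_ (n := m + 2) (m := m) (by omega)
    (fun h => absurd (neg_eq_zero.1 h) (by exact_mod_cast Nat.succ_ne_zero (m + 1)))
    (fun k => u k - (2 * k : F) • p k)
    (fun k => u (k + 1) + (2 * (m + 1 - k) : F) • p (k + 1)) (fun k _ => ?_)
    (fun k _ => ⟨p (k + 1), ?_⟩) H.linearIndependent_t₀_ker H.linearIndependent_t₀_range ?_ ?_
    ?_ ?_ s hs₀ hs₁ <;> simp only [h0, h1, h2, h3, ht]
  · simp
    ring
  · obtain _ | k := k <;> simp only [map_sub, map_smul, H.t0u, H.t0p, H.p_zero] <;> push_cast <;>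
      module
  · rw [H.t0p]
    push_cast
    module
  · exact H.bidiagonal_t₀_ker
  · exact H.bidiagonal_t₀_range
  · simp
    ring
  · simp
    ring

/-- The composition factors of `E_d(a,b,c)^{(1,-1)}` for `d = 2 * m + 1`. -/
theorem IsZetaTwist.composition_factors_t₁
    (hη : ∀ (r : RacahAlg F) (v : V), r • v = η r • v) (hπ : IsZetaTwist π η)
    (h0 : π 0 = 1) (h1 : π 1 = 0) (h2 : π 2 = 3) (h3 : π 3 = 2)
    (H : IsEdSeq (tEnd F V) a b c m u p) (hV : Module.finrank F V = m + 1 + (m + 1))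
    (s : CompositionSeries (Submodule (RacahAlg F) V)) (hs₀ : s.head = ⊥) (hs₁ : s.last = ⊤) :
    s.length = 2 ∧ ∃ i j : Fin s.length, i ≠ j ∧
      IsRdModule F (-a / 2) (-(b + 1) / 2) (-(c + 1) / 2) m (csFactor s i) ∧
      IsRdModule F (-a / 2 - 1) (-(b + 1) / 2) (-(c + 1) / 2) m (csFactor s j) := by
  have ht : ∀ i (x : V), tGen F i • x = tEnd F V i x := fun _ _ => rfl
  suffices h : s.length = 2 ∧ ∃ i j : Fin s.length, i ≠ j ∧
      IsRdModule F (-a / 2 - 1) (-(b + 1) / 2) (-(c + 1) / 2) m (csFactor s i) ∧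
      IsRdModule F (-a / 2) (-(b + 1) / 2) (-(c + 1) / 2) m (csFactor s j) by
    obtain ⟨hs, i, j, hij, hi, hj⟩ := h
    exact ⟨hs, j, i, hij.symm, hj, hi⟩
  refine hπ.composition_factors hη H.sq_apply (-a) ?_ hV (fun _ => rfl) (fun k => p (k + 1))
    (fun k => (2 * a) • u k + p (k + 1) - (4 * k * (m + 1 - k) : F) • p k) (fun k _ => ?_)
    (fun k _ => ⟨u k, ?_⟩) H.linearIndependent_t₁_ker H.linearIndependent_t₁_range ?_ ?_ ?_ ?_
    s hs₀ hs₁ <;> simp only [h0, h1, h2, h3, ht]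
  · simp
  · exact H.t1p k
  · rw [H.t1u]
    module
  · exact H.bidiagonal_t₁_ker
  · exact H.bidiagonal_t₁_range
  · simp
    ring
  · simp
    ring

/-- The composition factors of `E_d(a,b,c)^{(-1,1)}` for `d = 2 * m + 1`. -/
theorem IsZetaTwist.composition_factors_t₂
    (hη : ∀ (r : RacahAlg F) (v : V), r • v = η r • v) (hπ : IsZetaTwist π η)
    (h0 : π 0 = 2) (h1 : π 1 = 3) (h2 : π 2 = 0) (h3 : π 3 = 1)
    (H : IsEdSeq (tEnd F V) a b c m u p) (hV : Module.finrank F V = m + 1 + (m + 1))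
    (s : CompositionSeries (Submodule (RacahAlg F) V)) (hs₀ : s.head = ⊥) (hs₁ : s.last = ⊤) :
    s.length = 2 ∧ ∃ i j : Fin s.length, i ≠ j ∧
      IsRdModule F (-(a + 1) / 2) (-b / 2) (-(c + 1) / 2) m (csFactor s i) ∧
      IsRdModule F (-(a + 1) / 2) (-b / 2 - 1) (-(c + 1) / 2) m (csFactor s j) := by
  have ht : ∀ i (x : V), tGen F i • x = tEnd F V i x := fun _ _ => rfl
  refine hπ.composition_factors hη H.sq_apply b ?_ hV (fun _ => rfl) (fun k => u k)
    (fun k => -((a + b - m + 2 * k) ^ 2 - c ^ 2) • u k - (2 * b) • p (k + 1) - u (k + 1))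
    (fun k _ => ?_) (fun k _ => ⟨p (k + 1), ?_⟩) H.linearIndependent_t₂_ker
    (H.linearIndependent_t₂_range fun W => eq_bot_or_eq_top_of_tGen_stable W) ?_ ?_ ?_ ?_
    s hs₀ hs₁ <;> simp only [h0, h1, h2, h3, ht]
  · simp
  · exact H.t2u k
  · rw [H.t2p]
    module
  · exact H.bidiagonal_t₂_ker
  · exact H.bidiagonal_t₂_range
  · simp
    ring
  · simp
    ring

/-- The composition factors of `E_d(a,b,c)^{(-1,-1)}` for `d = 2 * m + 1`. -/
theorem IsZetaTwist.composition_factors_t₃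
    (hη : ∀ (r : RacahAlg F) (v : V), r • v = η r • v) (hπ : IsZetaTwist π η)
    (h0 : π 0 = 3) (h1 : π 1 = 2) (h2 : π 2 = 1) (h3 : π 3 = 0)
    (H : IsEdSeq (tEnd F V) a b c m u p) (hV : Module.finrank F V = m + 1 + (m + 1))
    (s : CompositionSeries (Submodule (RacahAlg F) V)) (hs₀ : s.head = ⊥) (hs₁ : s.last = ⊤) :
    s.length = 2 ∧ ∃ i j : Fin s.length, i ≠ j ∧
      IsRdModule F (-(a + 1) / 2) (-(b + 1) / 2) (-c / 2) m (csFactor s i) ∧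
      IsRdModule F (-(a + 1) / 2) (-(b + 1) / 2) (-c / 2 - 1) m (csFactor s j) := by
  have ht : ∀ i (x : V), tGen F i • x = tEnd F V i x := fun _ _ => rfl
  refine hπ.composition_factors hη H.sq_apply c ?_ hV (fun _ => rfl)
    (fun k => p (k + 1) + (a + b - m + 2 * k - c) • u k)
    (fun k => p (k + 1) + (a + b - m + 2 * k + c) • u k)
    (fun k _ => ?_) (fun k _ => ⟨-u k, ?_⟩)
    (H.linearIndependent_t₃ fun k => a + b - m + 2 * k - c)
    (H.linearIndependent_t₃ fun k => a + b - m + 2 * k + c) ?_ ?_ ?_ ?_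
    s hs₀ hs₁ <;> simp only [h0, h1, h2, h3, ht]
  · simp
  · simp only [map_add, map_smul, H.t3u, H.t3p]
    module
  · rw [map_neg, H.t3u]
    module
  · exact H.bidiagonal_t₃_ker
  · exact H.bidiagonal_t₃_range
  · simp
    ring
  · simp
    ring

end Twists

theorem dahaAut_tGen {F : Type} [Field F] (π : Equiv.Perm (Fin 4)) (i : Fin 4) :
    dahaAut F π (tGen F i) = tGen F (π i) := by
  rw [dahaAut, tGen, RingQuot.liftAlgHom_mkAlgHom_apply, FreeAlgebra.lift_ι_apply]

theorem IsZeta.isZetaTwist_comp {F : Type} [Field F] {ζ : RacahAlg F →ₐ[F] DAHAAlg F}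
    (hζ : IsZeta F ζ) (π : Equiv.Perm (Fin 4)) : IsZetaTwist π ((dahaAut F π).comp ζ) := by
  obtain ⟨hA, hB, hC⟩ := hζ
  constructor <;> rw [AlgHom.comp_apply]
  · rw [hA]
    simp only [map_smul, map_mul, map_add, map_sub, map_one, dahaAut_tGen]
  · rw [hB]
    simp only [map_smul, map_mul, map_add, map_sub, map_one, dahaAut_tGen]
  · rw [hC]
    simp only [map_smul, map_mul, map_add, map_sub, map_one, dahaAut_tGen]

theorem isScalarTower_racahModOfDaha {F V : Type} [Field F] [AddCommGroup V] [Module F V]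
    [Module (DAHAAlg F) V] [IsScalarTower F (DAHAAlg F) V] (η : RacahAlg F →ₐ[F] DAHAAlg F) :
    letI : Module (RacahAlg F) V := racahModOfDaha F η V
    IsScalarTower F (RacahAlg F) V := by
  let _ : Module (RacahAlg F) V := racahModOfDaha F η V
  refine ⟨fun r x v => ?_⟩
  change η (r • x) • v = r • η x • v
  rw [map_smul, smul_assoc]

/-- Composition factors of the `ℜ`-modules `E_d(a,b,c)^ε` (where the
`ℜ`-module structure comes from `ζ`, twisted by the Klein-group automorphism `ε`). -/
theorem stmt16 (F : Type) [Field F] [IsAlgClosed F] [CharZero F]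
    (ζ : RacahAlg F →ₐ[F] DAHAAlg F) (hζ : IsZeta F ζ)
    (d : ℕ) (hd : Odd d) (a b c : F)
    (V : Type) [AddCommGroup V] [Module (DAHAAlg F) V]
    (hV : IsEdModule F a b c d V) (hirr : IsSimpleModule (DAHAAlg F) V) :
    (letI : Module (RacahAlg F) V := racahModOfDaha F ζ V;
      (d = 1 → IsSimpleModule (RacahAlg F) V ∧
        IsRdModule F (-(a + 1) / 2) (-(b + 1) / 2) (-(c + 1) / 2) 1 V) ∧
      (3 ≤ d →
        ∀ s : CompositionSeries (Submodule (RacahAlg F) V), s.head = ⊥ → s.last = ⊤ →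
          s.length = 2 ∧ ∃ i j : Fin s.length, i ≠ j ∧
            IsRdModule F (-(a + 1) / 2) (-(b + 1) / 2) (-(c + 1) / 2) ((d + 1) / 2)
              (csFactor s i) ∧
            IsRdModule F (-(a + 1) / 2) (-(b + 1) / 2) (-(c + 1) / 2) ((d - 3) / 2)
              (csFactor s j))) ∧
    (letI : Module (RacahAlg F) V :=
        racahModOfDaha F ((dahaAut F (permOf (1, -1))).comp ζ) V;
      ∀ s : CompositionSeries (Submodule (RacahAlg F) V), s.head = ⊥ → s.last = ⊤ →
        s.length = 2 ∧ ∃ i j : Fin s.length, i ≠ j ∧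
          IsRdModule F (-a / 2) (-(b + 1) / 2) (-(c + 1) / 2) ((d - 1) / 2) (csFactor s i) ∧
          IsRdModule F (-a / 2 - 1) (-(b + 1) / 2) (-(c + 1) / 2) ((d - 1) / 2)
            (csFactor s j)) ∧
    (letI : Module (RacahAlg F) V :=
        racahModOfDaha F ((dahaAut F (permOf (-1, 1))).comp ζ) V;
      ∀ s : CompositionSeries (Submodule (RacahAlg F) V), s.head = ⊥ → s.last = ⊤ →
        s.length = 2 ∧ ∃ i j : Fin s.length, i ≠ j ∧
          IsRdModule F (-(a + 1) / 2) (-b / 2) (-(c + 1) / 2) ((d - 1) / 2) (csFactor s i) ∧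
          IsRdModule F (-(a + 1) / 2) (-b / 2 - 1) (-(c + 1) / 2) ((d - 1) / 2)
            (csFactor s j)) ∧
    (letI : Module (RacahAlg F) V :=
        racahModOfDaha F ((dahaAut F (permOf (-1, -1))).comp ζ) V;
      ∀ s : CompositionSeries (Submodule (RacahAlg F) V), s.head = ⊥ → s.last = ⊤ →
        s.length = 2 ∧ ∃ i j : Fin s.length, i ≠ j ∧
          IsRdModule F (-(a + 1) / 2) (-(b + 1) / 2) (-c / 2) ((d - 1) / 2) (csFactor s i) ∧
          IsRdModule F (-(a + 1) / 2) (-(b + 1) / 2) (-c / 2 - 1) ((d - 1) / 2)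
            (csFactor s j)) := by
  obtain ⟨m, rfl⟩ := hd
  let _ : Module F V := resF F (DAHAAlg F) V
  have _ : IsScalarTower F (DAHAAlg F) V := resF_tower F (DAHAAlg F) V rfl
  obtain ⟨_, hfin, u, p, H⟩ := hV.exists_isEdSeq
  rw [show (2 * m + 1 - 1) / 2 = m by omega, show (2 * m + 1 + 1) / 2 = m + 1 by omega]
  have hζ₁ : IsZetaTwist 1 ζ := ⟨hζ.1, hζ.2.1, hζ.2.2⟩
  refine ⟨?_, ?_, ?_, ?_⟩
  · let _ : Module (RacahAlg F) V := racahModOfDaha F ζ V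
    have _ := isScalarTower_racahModOfDaha (V := V) ζ
    refine ⟨fun h => ?_, fun h => ?_⟩
    · obtain rfl : m = 0 := by omega
      exact hζ₁.simple_and_isRdModule_one (fun _ _ => rfl) rfl rfl rfl rfl H hfin
    · obtain ⟨m, rfl⟩ : ∃ l, m = l + 1 := ⟨m - 1, by omega⟩
      rw [show (2 * (m + 1) + 1 - 3) / 2 = m by omega]
      exact hζ₁.composition_factors_t₀ (fun _ _ => rfl) rfl rfl rfl rfl H hfin
  · let _ : Module (RacahAlg F) V := racahModOfDaha F ((dahaAut F (permOf (1, -1))).comp ζ) V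
    have _ := isScalarTower_racahModOfDaha (V := V) ((dahaAut F (permOf (1, -1))).comp ζ)
    exact (hζ.isZetaTwist_comp _).composition_factors_t₁ (fun _ _ => rfl)
      (by decide) (by decide) (by decide) (by decide) H hfin
  · let _ : Module (RacahAlg F) V := racahModOfDaha F ((dahaAut F (permOf (-1, 1))).comp ζ) V
    have _ := isScalarTower_racahModOfDaha (V := V) ((dahaAut F (permOf (-1, 1))).comp ζ)
    exact (hζ.isZetaTwist_comp _).composition_factors_t₂ (fun _ _ => rfl)
      (by decide) (by decide) (by decide) (by decide) H hfin
  · let _ : Module (RacahAlg F) V := racahModOfDaha F ((dahaAut F (permOf (-1, -1))).comp ζ) V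
    have _ := isScalarTower_racahModOfDaha (V := V) ((dahaAut F (permOf (-1, -1))).comp ζ)
    exact (hζ.isZetaTwist_comp _).composition_factors_t₃ (fun _ _ => rfl)
      (by decide) (by decide) (by decide) (by decide) H hfin
end

section
/- Let d ≥ 1 be an odd integer, let a, b, c ∈ F, and suppose the 𝔥-module E_d(a,b,c) is irreducible. Then the following are equivalent: (i) t₀+t₁ acts diagonalizably on E_d(a,b,c); (ii) t₀+t₁ acts multiplicity-freely on E_d(a,b,c); (iii) 2a is not among d−1, d−3, …, 1−d. -/
open FreeAlgebra

/-! ## Lower bidiagonal operators with unit subdiagonal -/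

section Bidiagonal

open Module Module.End Polynomial

theorem multFree_iff_nodup_roots_charpoly {K V : Type*} [Field K] [AddCommGroup V] [Module K V]
    [FiniteDimensional K V] (f : End K V) :
    (∀ μ : K, f.HasEigenvalue μ → finrank K (f.maxGenEigenspace μ) = 1) ↔
      f.charpoly.roots.Nodup := by
  classical
  rw [Multiset.nodup_iff_count_eq_one]
  simp only [hasEigenvalue_iff_isRoot_charpoly, LinearMap.finrank_maxGenEigenspace_eq,
    count_roots, mem_roots f.charpoly_monic.ne_zero]

theorem iSup_eigenspace_eq_top_of_multFree {K V : Type*} [Field K] [IsAlgClosed K]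
    [AddCommGroup V] [Module K V] [FiniteDimensional K V] (f : End K V)
    (h : ∀ μ : K, f.HasEigenvalue μ → finrank K (f.maxGenEigenspace μ) = 1) :
    (⨆ μ : K, f.eigenspace μ) = ⊤ := by
  rw [eq_top_iff, ← iSup_maxGenEigenspace_eq_top f]
  refine iSup_mono fun μ => ?_
  by_cases hμ : f.HasEigenvalue μ
  · refine (Submodule.eq_of_le_of_finrank_le eigenspace_le_maxGenEigenspace ?_).ge
    rw [h μ hμ]
    exact Submodule.one_le_finrank_iff.2 hμ
  · rw [hasEigenvalue_iff_isRoot_charpoly] at hμ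
    have h0 : finrank K (f.maxGenEigenspace μ) = 0 := by
      rw [LinearMap.finrank_maxGenEigenspace_eq, rootMultiplicity_eq_zero hμ]
    rw [Submodule.finrank_eq_zero.1 h0]
    exact bot_le

theorem maxGenEigenspace_eq_eigenspace_of_iSup_eq_top {K V : Type*} [Field K]
    [AddCommGroup V] [Module K V] (f : End K V) (h : (⨆ μ : K, f.eigenspace μ) = ⊤) (μ : K) :
    f.maxGenEigenspace μ = f.eigenspace μ := by
  refine (eq_of_le_of_inf_le_of_sup_le (z := ⨆ (ν : K) (_ : ν ≠ μ), f.eigenspace ν)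
    eigenspace_le_maxGenEigenspace ?_ ?_).symm
  · refine le_trans ?_ bot_le
    refine le_trans (inf_le_inf_left _ ?_) (f.independent_maxGenEigenspace μ).le_bot
    exact iSup₂_mono fun ν _ => eigenspace_le_maxGenEigenspace
  · refine le_top.trans ?_
    rw [← h]
    refine iSup_le fun ν => ?_
    by_cases hν : ν = μ
    · rw [hν]; exact le_sup_left
    · exact le_sup_of_le_right
        (le_iSup₂_of_le (f := fun (ν : K) (_ : ν ≠ μ) => f.eigenspace ν) ν hν le_rfl)

variable {K V : Type*} [Field K] [AddCommGroup V] [Module K V] {n : ℕ}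
  (v : Basis (Fin (n + 1)) K V) {w : ℕ → V} (hw : ∀ i : Fin (n + 1), w i = v i)
  (hw0 : w (n + 1) = 0) {f : End K V} {θ : ℕ → K}
  (hf : ∀ i ≤ n, f (w i) = θ i • w i + w (i + 1))

include hw hf in
theorem finrank_eigenspace_le_one_of_bidiagonal (μ : K) :
    finrank K (f.eigenspace μ) ≤ 1 := by
  have : FiniteDimensional K V := v.finiteDimensional_of_finite
  set g := f - μ • (1 : End K V) with hg
  have hmem : ∀ i ≤ n, w i ∈ g.range ⊔ K ∙ w 0 := by
    intro i
    induction i with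
    | zero =>
      intro _
      exact Submodule.mem_sup_right (Submodule.mem_span_singleton_self _)
    | succ i ih =>
      intro hi
      have h1 : w (i + 1) = g (w i) + (μ - θ i) • w i := by
        rw [hg, LinearMap.sub_apply, hf i (by omega), LinearMap.smul_apply, End.one_apply]
        module
      rw [h1]
      exact add_mem (Submodule.mem_sup_left ⟨_, rfl⟩) (Submodule.smul_mem _ _ (ih (by omega)))
  have htop : g.range ⊔ K ∙ w 0 = ⊤ := by
    rw [eq_top_iff, ← v.span_eq, Submodule.span_le]
    rintro _ ⟨i, rfl⟩
    rw [← hw]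
    exact hmem i (by omega)
  have h2 := Submodule.finrank_add_le_finrank_add_finrank g.range (K ∙ w 0)
  have h3 : finrank K (K ∙ w 0) ≤ 1 := by
    simpa using finrank_span_le_card (R := K) ({w 0} : Set V)
  have h4 := g.finrank_range_add_finrank_ker
  rw [htop, finrank_top] at h2
  rw [eigenspace_def, ← hg]
  omega

include hw hw0 hf in
theorem roots_charpoly_of_bidiagonal [FiniteDimensional K V] :
    f.charpoly.roots = (Finset.univ : Finset (Fin (n + 1))).val.map fun i : Fin (n + 1) => θ i := by
  have hentry : ∀ i j : Fin (n + 1), LinearMap.toMatrix v v f i j =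
      (if i = j then θ j else 0) + if (i : ℕ) = j + 1 then 1 else 0 := by
    intro i j
    rw [LinearMap.toMatrix_apply, ← hw, hf j (by omega), map_add, map_smul, hw]
    by_cases hj : (j : ℕ) + 1 < n + 1
    · rw [show w (j + 1) = v ⟨j + 1, hj⟩ from hw ⟨j + 1, hj⟩]
      simp [Finsupp.single_apply, Fin.ext_iff, eq_comm]
    · have hj' : (j : ℕ) + 1 = n + 1 := by omega
      have hi : (i : ℕ) ≠ j + 1 := by omega
      rw [hj', hw0]
      rw [hj'] at hi
      simp [Finsupp.single_apply, hi, eq_comm]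
  rw [← LinearMap.charpoly_toMatrix f v, ← Matrix.charpoly_transpose,
    Matrix.charpoly_of_isUpperTriangular]
  · have hdiag : ∀ i : Fin (n + 1), (LinearMap.toMatrix v v f).transpose i i = θ i := by
      intro i
      simp [Matrix.transpose_apply, hentry]
    simp only [hdiag]
    rw [← roots_multiset_prod_X_sub_C (Multiset.map (fun i : Fin (n + 1) => θ i) _),
      Multiset.map_map]
    rfl
  · intro i j hij
    simp only [id] at hij
    rw [Matrix.transpose_apply, hentry, if_neg hij.ne, if_neg (by omega), add_zero]

include hw hw0 hf in
theorem multFree_iff_injOn_of_bidiagonal :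
    (∀ μ : K, f.HasEigenvalue μ → finrank K (f.maxGenEigenspace μ) = 1) ↔
      ∀ i ≤ n, ∀ j ≤ n, θ i = θ j → i = j := by
  have : FiniteDimensional K V := v.finiteDimensional_of_finite
  rw [multFree_iff_nodup_roots_charpoly, roots_charpoly_of_bidiagonal v hw hw0 hf,
    Multiset.nodup_map_iff_inj_on Finset.univ.nodup]
  constructor
  · intro h i hi j hj hij
    exact congrArg Fin.val (h ⟨i, by omega⟩ (by simp) ⟨j, by omega⟩ (by simp) hij)
  · intro h i _ j _ hij
    exact Fin.ext (h i (by omega) j (by omega) hij)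

include hw hf in
theorem iSup_eigenspace_eq_top_iff_multFree_of_bidiagonal [IsAlgClosed K] :
    (⨆ μ : K, f.eigenspace μ) = ⊤ ↔
      ∀ μ : K, f.HasEigenvalue μ → finrank K (f.maxGenEigenspace μ) = 1 := by
  have : FiniteDimensional K V := v.finiteDimensional_of_finite
  refine ⟨fun h μ hμ => ?_, iSup_eigenspace_eq_top_of_multFree f⟩
  rw [maxGenEigenspace_eq_eigenspace_of_iSup_eq_top f h]
  exact le_antisymm (finrank_eigenspace_le_one_of_bidiagonal v hw hf μ)
    (Submodule.one_le_finrank_iff.2 hμ)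

end Bidiagonal

/-! ## The action of `t₀ + t₁` on `E_d(a,b,c)` -/

/-- The diagonal entries of `t₀ + t₁` on `E_d(a,b,c)`. -/
def edDiag {K : Type*} [Field K] (a : K) (d i : ℕ) : K :=
  if Even i then a - ((d : K) + 1) / 2 + i else ((d : K) - 1) / 2 - i - a

theorem edDiag_injOn_iff {K : Type*} [Field K] [CharZero K] (a : K) {d : ℕ} (hd : Odd d) :
    (∀ i ≤ d, ∀ j ≤ d, edDiag a d i = edDiag a d j → i = j) ↔
      ∀ i : ℕ, i < d → 2 * a ≠ (d : K) - 1 - 2 * (i : K) := by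
  constructor
  · intro h k hk h2a
    obtain ⟨m, hm⟩ := hd
    obtain ⟨i, j, hi, hj, hid, hjd, hij⟩ :
        ∃ i j : ℕ, Even i ∧ ¬ Even j ∧ i ≤ d ∧ j ≤ d ∧ i + j = 2 * k + 1 := by
      rcases Nat.even_or_odd k with ⟨r, hr⟩ | ⟨r, hr⟩
      · exact ⟨k, k + 1, ⟨r, hr⟩, by rw [Nat.not_even_iff_odd]; exact ⟨r, by omega⟩,
          by omega, by omega, by omega⟩
      · exact ⟨k + 1, k, ⟨r + 1, by omega⟩, by rw [Nat.not_even_iff_odd]; exact ⟨r, by omega⟩,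
          by omega, by omega, by omega⟩
    have hc : (i : K) + j = 2 * k + 1 := by exact_mod_cast hij
    have heq : edDiag a d i = edDiag a d j := by
      rw [edDiag, edDiag, if_pos hi, if_neg hj]
      linear_combination h2a + hc
    exact hj (h i hid j hjd heq ▸ hi)
  · intro h
    have hne : ∀ i ≤ d, ∀ j ≤ d, Even i → ¬ Even j → edDiag a d i ≠ edDiag a d j := by
      intro i hi j hj hie hjo heq
      rw [edDiag, edDiag, if_pos hie, if_neg hjo] at heq
      rw [Nat.not_even_iff_odd] at hjo
      obtain ⟨r, hr⟩ := hie
      obtain ⟨s, hs⟩ := hjo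
      obtain ⟨m, hm⟩ := hd
      refine h (r + s) (by omega) ?_
      have hr' : (i : K) = r + r := by exact_mod_cast hr
      have hs' : (j : K) = 2 * s + 1 := by exact_mod_cast hs
      push_cast
      linear_combination heq - hr' - hs'
    intro i hi j hj heq
    by_cases hie : Even i <;> by_cases hje : Even j
    · rw [edDiag, edDiag, if_pos hie, if_pos hje] at heq
      exact_mod_cast (by linear_combination heq : (i : K) = j)
    · exact absurd heq (hne i hi j hj hie hje)
    · exact absurd heq.symm (hne j hj i hi hje hie)
    · rw [edDiag, edDiag, if_neg hie, if_neg hje] at heq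
      exact_mod_cast (by linear_combination -heq : (i : K) = j)

/-- Suppose `E_d(a,b,c)` (`d ≥ 1` odd) is irreducible.  TFAE:
(i) `t₀+t₁` acts diagonalizably on `E_d(a,b,c)`; (ii) `t₀+t₁` acts multiplicity-freely;
(iii) `2a` is not among `d-1, d-3, …, 1-d`. -/
theorem stmt17 (F : Type) [Field F] [IsAlgClosed F] [CharZero F] (a b c : F) (d : ℕ) (hd : Odd d)
    (V : Type) [AddCommGroup V] [Module (DAHAAlg F) V]
    (hV : IsEdModule F a b c d V) (hirr : IsSimpleModule (DAHAAlg F) V) :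
    (ActsDiagOn F (tGen F 0 + tGen F 1) V ↔ ActsMultFreeOn F (tGen F 0 + tGen F 1) V) ∧
    (ActsMultFreeOn F (tGen F 0 + tGen F 1) V ↔
      ∀ i : ℕ, i < d → 2 * a ≠ (d : F) - 1 - 2 * (i : F)) := by
  let := resF F (DAHAAlg F) V
  have := resF_tower F (DAHAAlg F) V rfl
  obtain ⟨v, w, hw, hwz, h0e, h0o, h00, h0d, h1e, h1o, h10, -⟩ := hV
  have hf : ∀ i ≤ d, opOf F (tGen F 0 + tGen F 1) V (w i) = edDiag a d i • w i + w (i + 1) := by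
    intro i hi
    change (tGen F 0 + tGen F 1) • w i = _
    rw [add_smul, edDiag]
    by_cases hie : Even i
    · rw [if_pos hie]
      rcases Nat.eq_zero_or_pos i with rfl | hpos
      · rw [h00, h10]
        push_cast
        module
      · have h2 : 2 ≤ i := by obtain ⟨r, hr⟩ := hie; omega
        have hlt : i + 1 ≤ d := by
          obtain ⟨r, hr⟩ := hie
          obtain ⟨m, hm⟩ := hd
          omega
        rw [h0e i hie h2 hlt, h1e i hie h2 hlt]
        module
    · rw [if_neg hie]
      rw [Nat.not_even_iff_odd] at hie
      rw [h1o i hie hi]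
      rcases hi.eq_or_lt with rfl | hlt
      · rw [h0d, hwz (i + 1) (by omega)]
        module
      · have hlt' : i + 2 ≤ d := by
          obtain ⟨r, hr⟩ := hie
          obtain ⟨m, hm⟩ := hd
          omega
        rw [h0o i hie hlt']
        module
  exact ⟨iSup_eigenspace_eq_top_iff_multFree_of_bidiagonal v hw hf,
    (multFree_iff_injOn_of_bidiagonal v hw (hwz (d + 1) (by omega)) hf).trans
      (edDiag_injOn_iff a hd)⟩
end
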